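/- Let d = 2 and W = ½w² where w ∈ C²(ℝ²,ℝ) satisfies the Tricomi equation ∂₁₁w(z) − f(z₁)∂₂₂w(z) = 0 for all z ∈ ℝ², for some f ∈ C¹(ℝ,ℝ) with |f| ≤ 1 on ℝ. Let u^± = (a,u₂^±) be two wells of W such that w > 0 on the open segment (u^-,u^+). If u is a global minimizer of problem (P) and either u ∈ L^∞ or |∇w| satisfies the growth condition |∇w(z)| ≤ C e^{β|z|²} for some C, β > 0, then u is one-dimensional: u = g(x₁) where g is the unique minimizer (up to translation) of the one-dimensional problem. -/

import Mathlib

open MeasureTheory Filter Topology ENNReal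

noncomputable section

/-- Squared Euclidean norm on `ℝ^d` (modelled as `Fin d → ℝ`). -/
def vnorm2 {d : ℕ} (v : Fin d → ℝ) : ℝ := ∑ i, v i ^ 2

/-- Partial derivative in the `i`-th coordinate direction of a map `ℝ^d → ℝ^d`. -/
def pd {d : ℕ} (i : Fin d) (u : (Fin d → ℝ) → Fin d → ℝ) (x : Fin d → ℝ) : Fin d → ℝ :=
  fderiv ℝ u x (Pi.single i 1)

/-- Partial derivative in the `i`-th coordinate direction of a scalar function on `ℝ^d`. -/
def pdS {d : ℕ} (i : Fin d) (w : (Fin d → ℝ) → ℝ) (x : Fin d → ℝ) : ℝ :=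
  fderiv ℝ w x (Pi.single i 1)

/-- Squared Frobenius norm `|∇u|²` of the Jacobian of `u`. -/
def gradSq {d : ℕ} (u : (Fin d → ℝ) → Fin d → ℝ) (x : Fin d → ℝ) : ℝ :=
  ∑ i, ∑ j, (pd i u x j) ^ 2

/-- Divergence-free condition `∇ ⋅ u = 0`. -/
def IsDivFree {d : ℕ} (u : (Fin d → ℝ) → Fin d → ℝ) : Prop :=
  ∀ x, ∑ i, pd i u x i = 0

/-- Periodicity (period 1) in the last `d-1` coordinates: `u` is a map on `Ω = ℝ × 𝕋^{d-1}`. -/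
def IsPeriodic {d : ℕ} [NeZero d] (u : (Fin d → ℝ) → Fin d → ℝ) : Prop :=
  ∀ (x : Fin d → ℝ) (i : Fin d), i ≠ 0 → u (x + Pi.single i 1) = u x

/-- Fundamental domain `ℝ × [0,1)^{d-1}` of `Ω = ℝ × 𝕋^{d-1}`. -/
def strip (d : ℕ) [NeZero d] : Set (Fin d → ℝ) :=
  {x | ∀ i : Fin d, i ≠ 0 → x i ∈ Set.Ico (0 : ℝ) 1}

/-- The unit cube `[0,1)^d`. -/
def cube (d : ℕ) : Set (Fin d → ℝ) := Set.univ.pi fun _ => Set.Ico (0 : ℝ) 1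

/-- The `x'`-average `ū(t) = ∫_{𝕋^{d-1}} u(t,x') dx'`. -/
def avg {d : ℕ} [NeZero d] (u : (Fin d → ℝ) → Fin d → ℝ) (t : ℝ) : Fin d → ℝ :=
  ∫ y in cube d, u (Function.update y 0 t)

/-- Energy density `½|∇u|² + W(u)`. -/
def eden {d : ℕ} (W : (Fin d → ℝ) → ℝ) (u : (Fin d → ℝ) → Fin d → ℝ) (x : Fin d → ℝ) : ℝ :=
  (1 / 2) * gradSq u x + W (u x)

/-- Total energy `E(u)` on `Ω`, with values in `[0,∞]`. -/
def energy (d : ℕ) [NeZero d] (W : (Fin d → ℝ) → ℝ) (u : (Fin d → ℝ) → Fin d → ℝ) : ℝ≥0∞ :=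
  ∫⁻ x in strip d, ENNReal.ofReal (eden W u x)

/-- Membership in `Ḣ¹_div(Ω, ℝ^d)` (with classical derivatives). -/
def Adm (d : ℕ) [NeZero d] (u : (Fin d → ℝ) → Fin d → ℝ) : Prop :=
  Differentiable ℝ u ∧ IsPeriodic u ∧ IsDivFree u ∧ IntegrableOn (gradSq u) (strip d)

/-- The boundary conditions `ū(-∞) = u⁻`, `ū(+∞) = u⁺`. -/
def BdryCond (d : ℕ) [NeZero d] (u : (Fin d → ℝ) → Fin d → ℝ) (um up : Fin d → ℝ) : Prop :=
  Tendsto (avg u) atBot (𝓝 um) ∧ Tendsto (avg u) atTop (𝓝 up)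

/-- `S_a`: the zeros of `W` in the hyperplane `{z₁ = a}`. -/
def wellSet (d : ℕ) [NeZero d] (W : (Fin d → ℝ) → ℝ) (a : ℝ) : Set (Fin d → ℝ) :=
  {z | z 0 = a ∧ W z = 0}

/-- Hypothesis (H2): `liminf_{z₁ → a, |z'| → ∞} W(z₁,z') > 0`. -/
def H2cond (d : ℕ) [NeZero d] (W : (Fin d → ℝ) → ℝ) (a : ℝ) : Prop :=
  ∃ c > (0 : ℝ), ∃ δ > (0 : ℝ), ∃ R : ℝ, ∀ z : Fin d → ℝ,
    |z 0 - a| < δ → R ≤ ∑ i, (if i = (0 : Fin d) then 0 else z i ^ 2) → c ≤ W z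

/-- An admissible one-dimensional transition layer: a curve in the hyperplane `{z₁ = a}`
connecting `u⁻` (at `-∞`) to `u⁺` (at `+∞`). -/
def Adm1D (d : ℕ) [NeZero d] (a : ℝ) (um up : Fin d → ℝ) (γ : ℝ → Fin d → ℝ) : Prop :=
  Differentiable ℝ γ ∧ (∀ t, γ t 0 = a) ∧
  Tendsto γ atBot (𝓝 um) ∧ Tendsto γ atTop (𝓝 up)

/-- One-dimensional energy `∫_ℝ ½|γ̇|² + W(γ)`. -/
def energy1D (d : ℕ) (W : (Fin d → ℝ) → ℝ) (γ : ℝ → Fin d → ℝ) : ℝ≥0∞ :=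
  ∫⁻ t : ℝ, ENNReal.ofReal ((1 / 2) * vnorm2 (deriv γ t) + W (γ t))

/-- Geodesic (pseudo-)distance `geod^a_F(x,y)` in the hyperplane `{z₁ = a}` for the degenerate
metric `2 F g₀`: infimum of `∫_{-1}^{1} √(2F(γ)) |γ̇| dt` over Lipschitz curves in the
hyperplane joining `x` to `y`. -/
def geodA (d : ℕ) [NeZero d] (F : (Fin d → ℝ) → ℝ) (a : ℝ) (x y : Fin d → ℝ) : ℝ :=
  sInf {L | ∃ γ : ℝ → Fin d → ℝ, (∃ K : NNReal, LipschitzWith K γ) ∧ (∀ t, γ t 0 = a) ∧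
    γ (-1) = x ∧ γ 1 = y ∧
    L = ∫ t in Set.Icc (-1 : ℝ) 1, Real.sqrt (2 * F (γ t)) * Real.sqrt (vnorm2 (deriv γ t))}

/-- `g : ℝ × ℝ → ℝ` is differentiable everywhere, with partial derivatives `gx` and `gy`. -/
def HasGrad (g gx gy : ℝ × ℝ → ℝ) : Prop :=
  ∀ p, HasFDerivAt g
    (gx p • ContinuousLinearMap.fst ℝ ℝ ℝ + gy p • ContinuousLinearMap.snd ℝ ℝ ℝ) p

/-- Periodicity with period `1` in the second variable. -/
def PerY (g : ℝ × ℝ → ℝ) : Prop := ∀ x y, g (x, y + 1) = g (x, y)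

/-- The rectangle `[s,t] × [0,1]`. -/
def box (s t : ℝ) : Set (ℝ × ℝ) := Set.Icc (s, 0) (t, 1)

/-- Lebesgue measure restricted to the rectangle `[s,t] × [0,1]`. -/
def boxVol (s t : ℝ) : Measure (ℝ × ℝ) := volume.restrict (box s t)

namespace HasGrad

variable {g gx gy h hx hy : ℝ × ℝ → ℝ}

lemma continuous (hg : HasGrad g gx gy) : Continuous g :=
  continuous_iff_continuousAt.2 fun p => (hg p).continuousAt

lemma hasDerivAt_fst (hg : HasGrad g gx gy) (x y : ℝ) :
    HasDerivAt (fun x => g (x, y)) (gx (x, y)) x := by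
  have h1 : HasDerivAt (fun x : ℝ => (x, y)) ((1 : ℝ), (0 : ℝ)) x :=
    (hasDerivAt_id x).prodMk (hasDerivAt_const x y)
  simpa [Function.comp_def] using (hg (x, y)).comp_hasDerivAt x h1

lemma hasDerivAt_snd (hg : HasGrad g gx gy) (x y : ℝ) :
    HasDerivAt (fun y => g (x, y)) (gy (x, y)) y := by
  have h1 : HasDerivAt (fun y : ℝ => (x, y)) ((0 : ℝ), (1 : ℝ)) y :=
    (hasDerivAt_const y x).prodMk (hasDerivAt_id y)
  simpa [Function.comp_def] using (hg (x, y)).comp_hasDerivAt y h1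

lemma measurable_fst (hg : HasGrad g gx gy) : Measurable gx := by
  have := measurable_fderiv_apply_const ℝ g ((1 : ℝ), (0 : ℝ))
  convert this using 2 with p
  simp [(hg p).fderiv]

lemma measurable_snd (hg : HasGrad g gx gy) : Measurable gy := by
  have := measurable_fderiv_apply_const ℝ g ((0 : ℝ), (1 : ℝ))
  convert this using 2 with p
  simp [(hg p).fderiv]

lemma congr {gx' gy' : ℝ × ℝ → ℝ} (hg : HasGrad g gx gy) (h1 : ∀ p, gx p = gx' p)
    (h2 : ∀ p, gy p = gy' p) : HasGrad g gx' gy' := fun p => by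
  rw [← h1, ← h2]; exact hg p

lemma add (hg : HasGrad g gx gy) (hh : HasGrad h hx hy) :
    HasGrad (fun p => g p + h p) (fun p => gx p + hx p) (fun p => gy p + hy p) := fun p =>
  ((hg p).add (hh p)).congr_fderiv (by ext <;> simp)

lemma mul (hg : HasGrad g gx gy) (hh : HasGrad h hx hy) :
    HasGrad (fun p => g p * h p) (fun p => gx p * h p + g p * hx p)
      (fun p => gy p * h p + g p * hy p) := fun p =>
  ((hg p).mul (hh p)).congr_fderiv (by ext <;> simp <;> ring)

lemma const_mul (hg : HasGrad g gx gy) (c : ℝ) :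
    HasGrad (fun p => c * g p) (fun p => c * gx p) (fun p => c * gy p) := fun p =>
  ((hg p).const_mul c).congr_fderiv (by ext <;> simp)

lemma scomp (hg : HasGrad g gx gy) {φ φ' : ℝ → ℝ} (hφ : ∀ r, HasDerivAt φ (φ' r) r) :
    HasGrad (fun p => φ (g p)) (fun p => φ' (g p) * gx p) (fun p => φ' (g p) * gy p) := fun p =>
  ((hφ (g p)).comp_hasFDerivAt p (hg p)).congr_fderiv (by ext <;> simp)

lemma comp2 (hg : HasGrad g gx gy) (hh : HasGrad h hx hy) {Φ Φ1 Φ2 : ℝ × ℝ → ℝ}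
    (hΦ : HasGrad Φ Φ1 Φ2) :
    HasGrad (fun p => Φ (g p, h p)) (fun p => Φ1 (g p, h p) * gx p + Φ2 (g p, h p) * hx p)
      (fun p => Φ1 (g p, h p) * gy p + Φ2 (g p, h p) * hy p) := fun p =>
  ((hΦ (g p, h p)).comp p ((hg p).prodMk (hh p))).congr_fderiv (by ext <;> simp)

lemma of_fst {φ φ' : ℝ → ℝ} (hφ : ∀ r, HasDerivAt φ (φ' r) r) :
    HasGrad (fun p => φ p.1) (fun p => φ' p.1) (fun _ => 0) := fun p =>
  ((hφ p.1).comp_hasFDerivAt p (hasFDerivAt_fst (𝕜 := ℝ) (p := p))).congr_fderiv (by ext <;> simp)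

lemma of_const (c : ℝ) : HasGrad (fun _ => c) (fun _ => 0) (fun _ => 0) := fun p =>
  (hasFDerivAt_const c p).congr_fderiv (by ext <;> simp)

lemma shift (hg : HasGrad g gx gy) (e : ℝ) :
    HasGrad (fun p => g (p.1, p.2 + e)) (fun p => gx (p.1, p.2 + e))
      (fun p => gy (p.1, p.2 + e)) := fun p => by
  have h1 : HasFDerivAt (fun p : ℝ × ℝ => (p.1, p.2 + e)) (ContinuousLinearMap.id ℝ (ℝ × ℝ)) p :=
    (hasFDerivAt_fst.prodMk (hasFDerivAt_snd.add_const e)).congr_fderiv (by ext <;> simp)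
  exact ((hg (p.1, p.2 + e)).comp p h1).congr_fderiv (by ext <;> simp)

lemma periodic_snd (hg : HasGrad g gx gy) (hp : PerY g) : PerY gy := fun x y => by
  have h1 := hg.hasDerivAt_snd x y
  have h2 := (hg.shift 1).hasDerivAt_snd x y
  simp only [hp x _] at h2
  exact h2.unique h1

lemma periodic_fst (hg : HasGrad g gx gy) (hp : PerY g) : PerY gx := fun x y => by
  have h1 := hg.hasDerivAt_fst x y
  have h2 := (hg.shift 1).hasDerivAt_fst x y
  simp only [hp _ y] at h2
  exact h2.unique h1

end HasGrad

lemma box_eq (s t : ℝ) : box s t = Set.Icc s t ×ˢ Set.Icc (0 : ℝ) 1 := by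
  rw [box, ← Set.Icc_prod_Icc]

lemma isCompact_box (s t : ℝ) : IsCompact (box s t) := isCompact_Icc

lemma measurableSet_box (s t : ℝ) : MeasurableSet (box s t) := measurableSet_Icc

lemma boxVol_eq (s t : ℝ) :
    boxVol s t = (volume.restrict (Set.Icc s t)).prod (volume.restrict (Set.Icc (0 : ℝ) 1)) := by
  rw [boxVol, box_eq, Measure.volume_eq_prod, Measure.prod_restrict]

instance (s t : ℝ) : IsFiniteMeasure (boxVol s t) :=
  ⟨by rw [boxVol, Measure.restrict_apply_univ]; exact (isCompact_box s t).measure_lt_top⟩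

lemma Continuous.memLp_box {g : ℝ × ℝ → ℝ} (hg : Continuous g) (s t : ℝ) (q : ℝ≥0∞) :
    MemLp g q (boxVol s t) := by
  obtain ⟨C, hC⟩ := (isCompact_box s t).exists_bound_of_continuousOn hg.continuousOn
  refine MemLp.of_bound hg.aestronglyMeasurable C ?_
  exact (ae_restrict_iff' (measurableSet_box s t)).2 (Eventually.of_forall hC)

lemma Continuous.integrable_box {g : ℝ × ℝ → ℝ} (hg : Continuous g) (s t : ℝ) :
    Integrable g (boxVol s t) := memLp_one_iff_integrable.1 (hg.memLp_box s t 1)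

lemma Continuous.memLp_mul_box {g h : ℝ × ℝ → ℝ} (hg : Continuous g) {s t : ℝ} {q : ℝ≥0∞}
    (hh : MemLp h q (boxVol s t)) : MemLp (fun p => g p * h p) q (boxVol s t) := by
  exact hh.mul (hg.memLp_box s t ∞)

lemma integrable_mul_of_sq {α : Type*} [MeasurableSpace α] {μ : Measure α} {g h : α → ℝ}
    (hg : MemLp g 2 μ) (hh : MemLp h 2 μ) : Integrable (fun p => g p * h p) μ :=
  hg.integrable_mul hh

lemma integral_div_box {A Ax Ay B Bx By : ℝ × ℝ → ℝ} (hA : HasGrad A Ax Ay) (hB : HasGrad B Bx By)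
    (hp : PerY B) {s t : ℝ} (hst : s ≤ t)
    (hi : Integrable (fun p => Ax p + By p) (boxVol s t)) :
    ∫ p, (Ax p + By p) ∂(boxVol s t) = (∫ y in (0 : ℝ)..1, A (t, y)) - ∫ y in (0 : ℝ)..1, A (s, y) := by
  have key := integral_divergence_prod_Icc_of_hasFDerivAt_of_le A B _ _ (s, 0) (t, 1)
    (Prod.mk_le_mk.2 ⟨hst, zero_le_one⟩) hA.continuous.continuousOn hB.continuous.continuousOn
    (fun p _ => hA p) (fun p _ => hB p) (by simpa [IntegrableOn, boxVol, box] using hi)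
  have h01 : ∀ x, B (x, 1) = B (x, 0) := fun x => by simpa using hp x 0
  simpa [h01, boxVol, box] using key

lemma tendsto_integral_mul_of_sq_le {α : Type*} [MeasurableSpace α] {μ : Measure α}
    {f g : α → ℝ} {F : ℕ → α → ℝ} (hf : MemLp f 2 μ) (hg : MemLp g 2 μ)
    (hF : ∀ n, MemLp (F n) 2 μ) (hle : ∀ n, ∫ x, F n x ^ 2 ∂μ ≤ ∫ x, f x ^ 2 ∂μ)
    (hlim : ∀ x, Tendsto (fun n => F n x) atTop (𝓝 (f x))) :
    Tendsto (fun n => ∫ x, F n x * g x ∂μ) atTop (𝓝 (∫ x, f x * g x ∂μ)) := by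
  have one_sided : ∀ g : α → ℝ, MemLp g 2 μ → ∀ δ > 0, ∀ᶠ n in atTop,
      ∫ x, f x * g x ∂μ - δ < ∫ x, F n x * g x ∂μ := by
    intro g hg δ hδ
    have expand : ∀ k : α → ℝ, MemLp k 2 μ → ∫ x, (k x + g x) ^ 2 ∂μ =
        ∫ x, k x ^ 2 ∂μ + 2 * ∫ x, k x * g x ∂μ + ∫ x, g x ^ 2 ∂μ := by
      intro k hk
      have : (fun x => (k x + g x) ^ 2) = fun x => (k x ^ 2 + 2 * (k x * g x)) + g x ^ 2 := by
        ext x; ring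
      have hkg := (integrable_mul_of_sq hk hg).const_mul 2
      have hadd : Integrable (fun x => k x ^ 2 + 2 * (k x * g x)) μ := hk.integrable_sq.add hkg
      rw [this, integral_add hadd hg.integrable_sq,
        integral_add hk.integrable_sq hkg, integral_const_mul]
    have fatou : ENNReal.ofReal (∫ x, (f x + g x) ^ 2 ∂μ) ≤
        liminf (fun n => ENNReal.ofReal (∫ x, (F n x + g x) ^ 2 ∂μ)) atTop := by
      have e : ∀ k : α → ℝ, MemLp k 2 μ → ENNReal.ofReal (∫ x, (k x + g x) ^ 2 ∂μ) =
          ∫⁻ x, ENNReal.ofReal ((k x + g x) ^ 2) ∂μ := fun k hk =>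
        ofReal_integral_eq_lintegral_ofReal (hk.add hg).integrable_sq
          (Eventually.of_forall fun x => sq_nonneg _)
      rw [e f hf]
      simp_rw [fun n => e (F n) (hF n)]
      refine le_trans (lintegral_mono fun x => ?_) (lintegral_liminf_le' fun n =>
        ((((hF n).1.add hg.1).aemeasurable.pow_const 2)).ennreal_ofReal)
      refine le_of_eq (Tendsto.liminf_eq ?_).symm
      exact (ENNReal.continuous_ofReal.tendsto _).comp (((hlim x).add_const _).pow 2)
    by_cases hpos : ∫ x, (f x + g x) ^ 2 ∂μ - 2 * δ < 0
    · refine Eventually.of_forall fun n => ?_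
      have h1 := expand f hf
      have h2 := expand (F n) (hF n)
      have h3 : 0 ≤ ∫ x, (F n x + g x) ^ 2 ∂μ := integral_nonneg fun x => sq_nonneg _
      have h4 := hle n
      linarith
    · have h0 : ENNReal.ofReal (∫ x, (f x + g x) ^ 2 ∂μ - 2 * δ) <
          ENNReal.ofReal (∫ x, (f x + g x) ^ 2 ∂μ) := by
        rw [ENNReal.ofReal_lt_ofReal_iff_of_nonneg (not_lt.1 hpos)]; linarith
      filter_upwards [eventually_lt_of_lt_liminf (h0.trans_le fatou)] with n hn
      rw [ENNReal.ofReal_lt_ofReal_iff_of_nonneg (not_lt.1 hpos)] at hn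
      have h1 := expand f hf
      have h2 := expand (F n) (hF n)
      have h4 := hle n
      linarith
  rw [Metric.tendsto_atTop]
  intro δ hδ
  have h1 := one_sided g hg δ hδ
  have h2 := one_sided (fun x => -g x) hg.neg δ hδ
  simp only [mul_neg, integral_neg] at h2
  obtain ⟨N, hN⟩ := eventually_atTop.1 (h1.and h2)
  refine ⟨N, fun n hn => ?_⟩
  rw [Real.dist_eq, abs_lt]
  constructor <;> linarith [(hN n hn).1, (hN n hn).2]

lemma sq_intervalIntegral_le {h : ℝ → ℝ} {a b : ℝ} (hab : a ≤ b)
    (hi : IntervalIntegrable h volume a b)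
    (hi2 : IntervalIntegrable (fun y => h y ^ 2) volume a b) :
    (∫ y in a..b, h y) ^ 2 ≤ (b - a) * ∫ y in a..b, h y ^ 2 := by
  rcases hab.eq_or_lt with rfl | hlt
  · simp
  set I := ∫ y in a..b, h y with hI
  set c := I / (b - a) with hc
  have h0 : 0 ≤ ∫ y in a..b, (h y - c) ^ 2 :=
    intervalIntegral.integral_nonneg hab fun y _ => sq_nonneg _
  have h1 : ∫ y in a..b, (h y - c) ^ 2 = (∫ y in a..b, h y ^ 2) - 2 * c * I + c ^ 2 * (b - a) := by
    have : (fun y => (h y - c) ^ 2) = fun y => (h y ^ 2 - (2 * c) * h y) + c ^ 2 := by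
      ext y; ring
    rw [this, intervalIntegral.integral_add (hi2.sub (hi.const_mul _)) (by simp),
      intervalIntegral.integral_sub hi2 (hi.const_mul _), intervalIntegral.integral_const_mul]
    simp; ring
  have hba : 0 < b - a := sub_pos.2 hlt
  have hcI : c * (b - a) = I := by rw [hc]; field_simp
  rw [h1] at h0
  have h2 := mul_nonneg hba.le h0
  have h3 : (b - a) * ((∫ y in a..b, h y ^ 2) - 2 * c * I + c ^ 2 * (b - a)) =
      (b - a) * (∫ y in a..b, h y ^ 2) - 2 * (c * (b - a)) * I + (c * (b - a)) ^ 2 := by ring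
  rw [h3, hcI] at h2
  linarith

lemma PerY.lintegral_shift {G : ℝ → ℝ≥0∞} (hG : Function.Periodic G 1) (e : ℝ) :
    ∫⁻ y in Set.Icc (0 : ℝ) 1, G (y + e) = ∫⁻ y in Set.Icc (0 : ℝ) 1, G y := by
  have h1 : ∫⁻ y in Set.Icc (0 : ℝ) 1, G (y + e) = ∫⁻ y in Set.Ioc e (e + 1), G y := by
    have := (measurePreserving_add_right (volume : Measure ℝ) e).setLIntegral_comp_preimage_emb
      (measurableEmbedding_addRight e) G (Set.Icc e (e + 1))
    rw [Set.preimage_add_const_Icc] at this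
    simp only [sub_self, add_sub_cancel_left] at this
    rw [this, setLIntegral_congr Ioc_ae_eq_Icc]
  have h2 : ∫⁻ y in Set.Icc (0 : ℝ) 1, G y = ∫⁻ y in Set.Ioc (0 : ℝ) (0 + 1), G y := by
    rw [zero_add, setLIntegral_congr Ioc_ae_eq_Icc]
  rw [h1, h2]
  refine (isAddFundamentalDomain_Ioc one_pos e).setLIntegral_eq
    (isAddFundamentalDomain_Ioc one_pos 0) G ?_
  rintro ⟨_, n, rfl⟩ x
  have := hG.zsmul n x
  simpa [AddSubgroup.vadd_def, add_comm] using this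

namespace PerY

lemma aux_fun {β : Type*} {F : ℝ × ℝ → β} (hp : ∀ x y, F (x, y + 1) = F (x, y)) (x : ℝ) :
    Function.Periodic (fun y => F (x, y)) 1 := fun y => hp x y

lemma lintegral_box_shift {F : ℝ × ℝ → ℝ≥0∞} (hF : Measurable F)
    (hp : ∀ x y, F (x, y + 1) = F (x, y)) (s t e : ℝ) :
    ∫⁻ p, F (p.1, p.2 + e) ∂(boxVol s t) = ∫⁻ p, F p ∂(boxVol s t) := by
  rw [boxVol_eq, lintegral_prod _ (by fun_prop), lintegral_prod _ (by fun_prop)]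
  exact lintegral_congr fun x => lintegral_shift (aux_fun hp x) e

lemma memLp_shift {F : ℝ × ℝ → ℝ} (hF : Measurable F) (hp : PerY F) {s t : ℝ} (e : ℝ)
    (h2 : MemLp F 2 (boxVol s t)) : MemLp (fun p => F (p.1, p.2 + e)) 2 (boxVol s t) := by
  have hm : Measurable fun p : ℝ × ℝ => F (p.1, p.2 + e) := by fun_prop
  refine ⟨hm.aestronglyMeasurable, ?_⟩
  have h3 := h2.2
  rw [eLpNorm_lt_top_iff_lintegral_rpow_enorm_lt_top (by simp) (by simp)] at h3 ⊢
  rwa [lintegral_box_shift (F := fun p => ‖F p‖ₑ ^ (ENNReal.toReal 2)) (by fun_prop)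
    (fun x y => by simp only [hp x y])]

lemma integral_shift {F : ℝ → ℝ} (hp : Function.Periodic F 1) (e : ℝ) :
    ∫ y in Set.Icc (0 : ℝ) 1, F (y + e) = ∫ y in Set.Icc (0 : ℝ) 1, F y := by
  rw [integral_Icc_eq_integral_Ioc, integral_Icc_eq_integral_Ioc,
    ← intervalIntegral.integral_of_le zero_le_one, ← intervalIntegral.integral_of_le zero_le_one,
    intervalIntegral.integral_comp_add_right]
  simpa [add_comm] using hp.intervalIntegral_add_eq e 0

lemma integral_box_shift {F : ℝ × ℝ → ℝ} (hp : PerY F) {s t : ℝ} (e : ℝ)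
    (h1 : Integrable F (boxVol s t)) (h2 : Integrable (fun p => F (p.1, p.2 + e)) (boxVol s t)) :
    ∫ p, F (p.1, p.2 + e) ∂(boxVol s t) = ∫ p, F p ∂(boxVol s t) := by
  rw [boxVol_eq] at *
  rw [integral_prod _ h1, integral_prod _ h2]
  exact integral_congr_ae (Eventually.of_forall fun x => integral_shift (aux_fun hp x) e)

end PerY

/-- Difference quotients of a periodic function are bounded in `L²` by the derivative. -/
lemma integral_sq_diff_le {h h' : ℝ → ℝ} (hd : ∀ y, HasDerivAt h (h' y) y) (hm : Measurable h')
    (hp : Function.Periodic h' 1) (hi : IntegrableOn (fun y => h' y ^ 2) (Set.Icc 0 1)) (e : ℝ) :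
    ∫ y in Set.Icc (0 : ℝ) 1, (h (y + e) - h y) ^ 2 ≤
      e ^ 2 * ∫ y in Set.Icc (0 : ℝ) 1, h' y ^ 2 := by
  have i01 : IntervalIntegrable (fun y => h' y ^ 2) volume 0 (0 + 1) := by
    rw [zero_add, intervalIntegrable_iff_integrableOn_Icc_of_le zero_le_one]; exact hi
  have hp2 : Function.Periodic (fun y => h' y ^ 2) 1 := fun y => by simp only [hp y]
  have hi2 : ∀ a b, IntervalIntegrable (fun y => h' y ^ 2) volume a b :=
    fun a b => hp2.intervalIntegrable one_pos.ne' i01 a b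
  have hi1 : ∀ a b, IntervalIntegrable h' volume a b := fun a b => by
    refine ((hi2 a b).add (_root_.intervalIntegrable_const (c := (1 : ℝ)))).mono_fun hm.aestronglyMeasurable
      (Eventually.of_forall fun y => ?_)
    simp only [Real.norm_eq_abs]
    rw [abs_of_nonneg (by positivity : 0 ≤ h' y ^ 2 + 1), abs_le]
    constructor <;> nlinarith [sq_nonneg (h' y - 1), sq_nonneg (h' y + 1)]
  set K : ℝ → ℝ := fun y => ∫ r in (0 : ℝ)..y, h' r ^ 2 with hK
  have hKc : Continuous K := intervalIntegral.continuous_primitive hi2 0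
  have hKsub : ∀ a b, K b - K a = ∫ r in a..b, h' r ^ 2 := fun a b =>
    intervalIntegral.integral_interval_sub_left (hi2 0 b) (hi2 0 a)
  have hK1 : ∀ y, K (y + 1) - K y = K 1 := fun y => by
    rw [hKsub, hp2.intervalIntegral_add_eq y 0, zero_add]
  have hftc : ∀ a b, ∫ r in a..b, h' r = h b - h a := fun a b =>
    intervalIntegral.integral_eq_sub_of_hasDerivAt (fun x _ => hd x) (hi1 a b)
  have cs : ∀ y, (h (y + e) - h y) ^ 2 ≤ e * (K (y + e) - K y) := by
    intro y
    rcases le_total 0 e with he | he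
    · have := sq_intervalIntegral_le (by linarith : y ≤ y + e) (hi1 _ _) (hi2 _ _)
      rw [hftc, ← hKsub] at this
      simpa using this
    · have := sq_intervalIntegral_le (by linarith : y + e ≤ y) (hi1 _ _) (hi2 _ _)
      rw [hftc, ← hKsub] at this
      nlinarith
  have hKint : ∀ a b, IntervalIntegrable K volume a b := fun a b => hKc.intervalIntegrable a b
  have hKe : Continuous fun y => K (y + e) := by fun_prop
  have tot : ∫ y in (0 : ℝ)..1, (K (y + e) - K y) = e * K 1 := by
    rw [intervalIntegral.integral_sub (hKe.intervalIntegrable _ _) (hKint _ _),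
      intervalIntegral.integral_comp_add_right, zero_add]
    have h1 := intervalIntegral.integral_add_adjacent_intervals (hKint e 1) (hKint 1 (1 + e))
    have h2 := intervalIntegral.integral_add_adjacent_intervals (hKint 0 e) (hKint e 1)
    have h3 : ∫ y in (1 : ℝ)..(1 + e), K y = ∫ y in (0 : ℝ)..e, (K y + K 1) := by
      have := intervalIntegral.integral_comp_add_right (a := 0) (b := e) K 1
      rw [zero_add, add_comm e 1] at this
      rw [← this]
      exact intervalIntegral.integral_congr fun y _ => (by linarith [hK1 y] : K (y + 1) = K y + K 1)
    rw [intervalIntegral.integral_add (hKint _ _) (by simp)] at h3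
    simp at h3
    linarith
  have hhc : Continuous h := continuous_iff_continuousAt.2 fun y => (hd y).continuousAt
  have he : Continuous fun y => (h (y + e) - h y) ^ 2 := by fun_prop
  have hKec : Continuous fun y => e * (K (y + e) - K y) := by fun_prop
  calc ∫ y in Set.Icc (0 : ℝ) 1, (h (y + e) - h y) ^ 2
      = ∫ y in (0 : ℝ)..1, (h (y + e) - h y) ^ 2 := by
        rw [integral_Icc_eq_integral_Ioc, intervalIntegral.integral_of_le zero_le_one]
    _ ≤ ∫ y in (0 : ℝ)..1, e * (K (y + e) - K y) :=
        intervalIntegral.integral_mono_on zero_le_one (he.intervalIntegrable _ _)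
          (hKec.intervalIntegrable _ _) fun y _ => cs y
    _ = e ^ 2 * ∫ y in Set.Icc (0 : ℝ) 1, h' y ^ 2 := by
        rw [intervalIntegral.integral_const_mul, tot, hK]
        simp only
        rw [integral_Icc_eq_integral_Ioc, intervalIntegral.integral_of_le zero_le_one]
        ring

/-- The difference quotient of `h` in the second variable. -/
def dq (h : ℝ × ℝ → ℝ) (e : ℝ) (p : ℝ × ℝ) : ℝ := (h (p.1, p.2 + e) - h p) / e

lemma HasGrad.dq {h hx hy : ℝ × ℝ → ℝ} (hh : HasGrad h hx hy) (e : ℝ) :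
    HasGrad (dq h e) (dq hx e) (dq hy e) :=
  fun p => by
    have := (((hh.shift e).add (hh.const_mul (-1))).const_mul (1 / e)) p
    unfold _root_.dq
    convert this using 4 <;> ring

lemma integral_slice_dq_le {h hx hy : ℝ × ℝ → ℝ} (hh : HasGrad h hx hy) (hp : PerY h) {e : ℝ}
    (he : e ≠ 0) (x : ℝ) (hi : IntegrableOn (fun y => hy (x, y) ^ 2) (Set.Icc 0 1)) :
    ∫ y in Set.Icc (0 : ℝ) 1, dq h e (x, y) ^ 2 ≤ ∫ y in Set.Icc (0 : ℝ) 1, hy (x, y) ^ 2 := by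
  have := integral_sq_diff_le (fun y => hh.hasDerivAt_snd x y)
    (hh.measurable_snd.comp measurable_prodMk_left) (fun y => hh.periodic_snd hp x y) hi e
  have h2 : ∀ y, dq h e (x, y) ^ 2 = (1 / e ^ 2) * (h (x, y + e) - h (x, y)) ^ 2 := fun y => by
    simp only [dq]; field_simp
  simp_rw [h2]
  rw [integral_const_mul, one_div, inv_mul_le_iff₀ (by positivity)]
  exact this

lemma integral_box_dq_le {h hx hy : ℝ × ℝ → ℝ} (hh : HasGrad h hx hy) (hp : PerY h) {e : ℝ}
    (he : e ≠ 0) {s t : ℝ} (h2 : MemLp hy 2 (boxVol s t)) :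
    ∫ p, dq h e p ^ 2 ∂(boxVol s t) ≤ ∫ p, hy p ^ 2 ∂(boxVol s t) := by
  have i1 : Integrable (fun p => dq h e p ^ 2) (boxVol s t) :=
    ((hh.dq e).continuous.pow 2).integrable_box s t
  have i2 : Integrable (fun p => hy p ^ 2) (boxVol s t) := h2.integrable_sq
  rw [boxVol_eq] at *
  rw [integral_prod _ i1, integral_prod _ i2]
  refine integral_mono_ae i1.integral_prod_left i2.integral_prod_left ?_
  filter_upwards [i2.prod_right_ae] with x hx
  exact integral_slice_dq_le hh hp he x hx

lemma tendsto_dq {h hx hy : ℝ × ℝ → ℝ} (hh : HasGrad h hx hy) {e : ℕ → ℝ} (he0 : ∀ n, e n ≠ 0)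
    (he : Tendsto e atTop (𝓝 0)) (p : ℝ × ℝ) :
    Tendsto (fun n => dq h (e n) p) atTop (𝓝 (hy p)) := by
  have h1 := (hh.hasDerivAt_snd p.1 p.2).tendsto_slope_zero
  have h2 : Tendsto e atTop (𝓝[≠] 0) :=
    tendsto_nhdsWithin_iff.2 ⟨he, Eventually.of_forall fun n => he0 n⟩
  refine (h1.comp h2).congr fun n => ?_
  simp [dq, div_eq_inv_mul]

/-- Weak form of the fact that the Jacobian determinant is a null Lagrangian. -/
lemma tendsto_boundary_dq {g gx gy h hx hy : ℝ × ℝ → ℝ} (hg : HasGrad g gx gy)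
    (hh : HasGrad h hx hy) (pg : PerY g) (ph : PerY h) {s t : ℝ} (hst : s ≤ t)
    (gx2 : MemLp gx 2 (boxVol s t)) (gy2 : MemLp gy 2 (boxVol s t))
    (hx2 : MemLp hx 2 (boxVol s t)) (hy2 : MemLp hy 2 (boxVol s t))
    {e : ℕ → ℝ} (he0 : ∀ n, e n ≠ 0) (he : Tendsto e atTop (𝓝 0)) :
    Tendsto (fun n => (∫ y in (0 : ℝ)..1, g (t, y) * dq h (e n) (t, y)) -
        ∫ y in (0 : ℝ)..1, g (s, y) * dq h (e n) (s, y)) atTop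
      (𝓝 (∫ p, (gx p * hy p - gy p * hx p) ∂(boxVol s t))) := by
  have l1 := tendsto_integral_mul_of_sq_le hy2 gx2
    (fun n => (hh.dq (e n)).continuous.memLp_box s t 2)
    (fun n => integral_box_dq_le hh ph (he0 n) hy2) (tendsto_dq hh he0 he)
  have he' : Tendsto (fun n => -e n) atTop (𝓝 0) := by simpa using he.neg
  have he0' : ∀ n, -e n ≠ 0 := fun n => neg_ne_zero.2 (he0 n)
  have l2 := tendsto_integral_mul_of_sq_le gy2 hx2
    (fun n => (hg.dq (-e n)).continuous.memLp_box s t 2)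
    (fun n => integral_box_dq_le hg pg (he0' n) gy2) (tendsto_dq hg he0' he')
  have l3 := l1.sub l2
  have e1 : ∫ p, (gx p * hy p - gy p * hx p) ∂(boxVol s t) =
      ∫ p, hy p * gx p ∂(boxVol s t) - ∫ p, gy p * hx p ∂(boxVol s t) := by
    rw [← integral_sub (integrable_mul_of_sq hy2 gx2) (integrable_mul_of_sq gy2 hx2)]
    simp only [mul_comm]
  rw [e1]
  refine l3.congr fun n => ?_
  set d := e n
  have hd : d ≠ 0 := he0 n
  have hxs : MemLp (fun p => hx (p.1, p.2 + d)) 2 (boxVol s t) :=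
    (hh.periodic_fst ph).memLp_shift hh.measurable_fst d hx2
  have hdqx : MemLp (dq hx d) 2 (boxVol s t) := by
    have := (hxs.sub hx2).const_mul (1 / d)
    convert this using 2 with p
    simp [dq]; ring
  have iA : Integrable (fun p => gx p * dq h d p) (boxVol s t) :=
    integrable_mul_of_sq gx2 ((hh.dq d).continuous.memLp_box s t 2)
  have iB : Integrable (fun p => g p * dq hx d p) (boxVol s t) :=
    integrable_mul_of_sq (hg.continuous.memLp_box s t 2) hdqx
  have key := integral_div_box (hg.mul (hh.dq d)) (HasGrad.of_const 0) (fun _ _ => rfl) hst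
    (by simp only [add_zero]; exact iA.add iB)
  rw [← key]
  simp only [add_zero]
  rw [integral_add iA iB, sub_eq_add_neg, ← integral_neg]
  congr 1
  · simp only [mul_comm]
  have j1 : Integrable (fun p => g p * hx (p.1, p.2 + d)) (boxVol s t) :=
    integrable_mul_of_sq (hg.continuous.memLp_box s t 2) hxs
  have j2 : Integrable (fun p => g p * hx p) (boxVol s t) :=
    integrable_mul_of_sq (hg.continuous.memLp_box s t 2) hx2
  have hgs := (hg.shift (-d)).continuous
  have j3 : Integrable (fun p => g (p.1, p.2 + -d) * hx p) (boxVol s t) :=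
    integrable_mul_of_sq (hgs.memLp_box s t 2) hx2
  have sh : ∫ p, g p * hx (p.1, p.2 + d) ∂(boxVol s t) =
      ∫ p, g (p.1, p.2 + -d) * hx p ∂(boxVol s t) := by
    have pj : PerY fun p => g (p.1, p.2 + -d) * hx p := fun x y => by
      have := pg x (y + -d)
      rw [show y + -d + 1 = y + 1 + -d by ring] at this
      simp only [this, hh.periodic_fst ph x y]
    have := pj.integral_box_shift d j3 (by simpa using j1)
    simpa using this
  have s1 : ∫ p, g p * dq hx d p ∂(boxVol s t) = (1 / d) *
      (∫ p, g p * hx (p.1, p.2 + d) ∂(boxVol s t) - ∫ p, g p * hx p ∂(boxVol s t)) := by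
    rw [← integral_sub j1 j2, ← integral_const_mul]
    exact integral_congr_ae (Eventually.of_forall fun p => by simp only [dq]; ring)
  have s2 : ∫ p, -(dq g (-d) p * hx p) ∂(boxVol s t) = (1 / d) *
      (∫ p, g (p.1, p.2 + -d) * hx p ∂(boxVol s t) - ∫ p, g p * hx p ∂(boxVol s t)) := by
    rw [← integral_sub j3 j2, ← integral_const_mul]
    exact integral_congr_ae (Eventually.of_forall fun p => by simp only [dq, div_neg]; ring)
  rw [s1, s2, sh]

lemma integral_jacobian_eq_zero {g gx gy h hx hy : ℝ × ℝ → ℝ} (hg : HasGrad g gx gy)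
    (hh : HasGrad h hx hy) (pg : PerY g) (ph : PerY h) {s t : ℝ} (hst : s ≤ t)
    (gx2 : MemLp gx 2 (boxVol s t)) (gy2 : MemLp gy 2 (boxVol s t))
    (hx2 : MemLp hx 2 (boxVol s t)) (hy2 : MemLp hy 2 (boxVol s t))
    (h0s : ∀ y, g (s, y) = 0) (h0t : ∀ y, g (t, y) = 0) :
    ∫ p, (gx p * hy p - gy p * hx p) ∂(boxVol s t) = 0 := by
  have he : Tendsto (fun n : ℕ => 1 / ((n : ℝ) + 1)) atTop (𝓝 0) :=
    tendsto_one_div_add_atTop_nhds_zero_nat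
  have := tendsto_boundary_dq hg hh pg ph hst gx2 gy2 hx2 hy2 (fun n => by positivity) he
  simp only [h0s, h0t, zero_mul, intervalIntegral.integral_zero, sub_zero] at this
  exact tendsto_nhds_unique this tendsto_const_nhds

lemma abs_integral_mul_dq_le {g gx gy h hx hy : ℝ × ℝ → ℝ} (hg : HasGrad g gx gy)
    (hh : HasGrad h hx hy) (ph : PerY h) {x C δ e : ℝ} (he : e ≠ 0) (hδ : 0 < δ)
    (hC : ∀ y ∈ Set.Icc (0 : ℝ) 1, |g (x, y)| ≤ C)
    (hi : IntegrableOn (fun y => hy (x, y) ^ 2) (Set.Icc 0 1))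
    (hle : ∫ y in Set.Icc (0 : ℝ) 1, hy (x, y) ^ 2 ≤ δ ^ 2) :
    |∫ y in (0 : ℝ)..1, g (x, y) * dq h e (x, y)| ≤ C * δ := by
  have hC0 : 0 ≤ C := (abs_nonneg _).trans (hC 0 (by simp))
  have hsl := (integral_slice_dq_le hh ph he x hi).trans hle
  rw [integral_Icc_eq_integral_Ioc, ← intervalIntegral.integral_of_le zero_le_one] at hsl
  have c1 : Continuous fun y => dq h e (x, y) := (hh.dq e).continuous.comp (by fun_prop)
  have c2 : Continuous fun y => g (x, y) := hg.continuous.comp (by fun_prop)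
  calc |∫ y in (0 : ℝ)..1, g (x, y) * dq h e (x, y)|
      ≤ ∫ y in (0 : ℝ)..1, |g (x, y) * dq h e (x, y)| :=
        intervalIntegral.abs_integral_le_integral_abs zero_le_one
    _ ≤ ∫ y in (0 : ℝ)..1, (C * δ / 2 + C / (2 * δ) * dq h e (x, y) ^ 2) := by
        refine intervalIntegral.integral_mono_on zero_le_one
          ((c2.mul c1).abs.intervalIntegrable _ _) (Continuous.intervalIntegrable (by fun_prop) _ _)
          fun y hy => ?_
        rw [abs_mul]
        have h1 : |dq h e (x, y)| ≤ δ / 2 + 1 / (2 * δ) * dq h e (x, y) ^ 2 := by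
          rw [← sq_abs (dq h e (x, y))]
          have : δ / 2 + 1 / (2 * δ) * |dq h e (x, y)| ^ 2 - |dq h e (x, y)| =
            (|dq h e (x, y)| - δ) ^ 2 / (2 * δ) := by field_simp; ring
          have : 0 ≤ (|dq h e (x, y)| - δ) ^ 2 / (2 * δ) := by positivity
          linarith
        calc |g (x, y)| * |dq h e (x, y)| ≤ C * (δ / 2 + 1 / (2 * δ) * dq h e (x, y) ^ 2) :=
              mul_le_mul (hC y hy) h1 (abs_nonneg _) hC0
          _ = _ := by ring
    _ = C * δ / 2 + C / (2 * δ) * ∫ y in (0 : ℝ)..1, dq h e (x, y) ^ 2 := by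
        rw [intervalIntegral.integral_add (by simp)
          (Continuous.intervalIntegrable (by fun_prop) _ _), intervalIntegral.integral_const_mul]
        simp
    _ ≤ C * δ / 2 + C / (2 * δ) * δ ^ 2 := by gcongr
    _ = C * δ := by field_simp; ring

lemma abs_integral_jacobian_le {g gx gy h hx hy : ℝ × ℝ → ℝ} (hg : HasGrad g gx gy)
    (hh : HasGrad h hx hy) (pg : PerY g) (ph : PerY h) {s t : ℝ} (hst : s ≤ t)
    (gx2 : MemLp gx 2 (boxVol s t)) (gy2 : MemLp gy 2 (boxVol s t))
    (hx2 : MemLp hx 2 (boxVol s t)) (hy2 : MemLp hy 2 (boxVol s t)) {C δ : ℝ} (hδ : 0 < δ)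
    (hCs : ∀ y ∈ Set.Icc (0 : ℝ) 1, |g (s, y)| ≤ C)
    (hCt : ∀ y ∈ Set.Icc (0 : ℝ) 1, |g (t, y)| ≤ C)
    (his : IntegrableOn (fun y => hy (s, y) ^ 2) (Set.Icc 0 1))
    (hit : IntegrableOn (fun y => hy (t, y) ^ 2) (Set.Icc 0 1))
    (hles : ∫ y in Set.Icc (0 : ℝ) 1, hy (s, y) ^ 2 ≤ δ ^ 2)
    (hlet : ∫ y in Set.Icc (0 : ℝ) 1, hy (t, y) ^ 2 ≤ δ ^ 2) :
    |∫ p, (gx p * hy p - gy p * hx p) ∂(boxVol s t)| ≤ 2 * C * δ := by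
  have he : Tendsto (fun n : ℕ => 1 / ((n : ℝ) + 1)) atTop (𝓝 0) :=
    tendsto_one_div_add_atTop_nhds_zero_nat
  have hl := tendsto_boundary_dq hg hh pg ph hst gx2 gy2 hx2 hy2 (fun n => by positivity) he
  refine le_of_tendsto hl.abs (Eventually.of_forall fun n => ?_)
  have hn : 1 / ((n : ℝ) + 1) ≠ 0 := by positivity
  have h1 := abs_integral_mul_dq_le hg hh ph hn hδ hCs his hles
  have h2 := abs_integral_mul_dq_le hg hh ph hn hδ hCt hit hlet
  have h3 := abs_sub (∫ y in (0 : ℝ)..1, g (t, y) * dq h (1 / ((n : ℝ) + 1)) (t, y))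
    (∫ y in (0 : ℝ)..1, g (s, y) * dq h (1 / ((n : ℝ) + 1)) (s, y))
  linarith

lemma hasDerivAt_max_sq (r : ℝ) : HasDerivAt (fun r : ℝ => max r 0 ^ 2) (2 * max r 0) r := by
  rcases lt_trichotomy r 0 with h | rfl | h
  · have : (fun r : ℝ => max r 0 ^ 2) =ᶠ[𝓝 r] fun _ => 0 := by
      filter_upwards [Iio_mem_nhds h] with x hx
      rw [max_eq_right (Set.mem_Iio.1 hx).le]; norm_num
    rw [max_eq_right h.le, mul_zero]
    exact (hasDerivAt_const r 0).congr_of_eventuallyEq this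
  · rw [hasDerivAt_iff_isLittleO_nhds_zero]
    simp only [zero_add, max_self, mul_zero, smul_zero, sub_zero, ne_eq, OfNat.ofNat_ne_zero,
      not_false_eq_true, zero_pow]
    refine (Asymptotics.IsBigO.of_bound 1 (Eventually.of_forall fun x => ?_)).trans_isLittleO
      (Asymptotics.isLittleO_pow_id one_lt_two)
    simp only [norm_pow, Real.norm_eq_abs, one_mul]
    have hle : |max x 0| ≤ |x| := by
      rcases le_total x 0 with h | h
      · rw [max_eq_right h, abs_zero]; exact abs_nonneg x
      · rw [max_eq_left h]
    exact pow_le_pow_left₀ (abs_nonneg _) hle 2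
  · have : (fun r : ℝ => max r 0 ^ 2) =ᶠ[𝓝 r] fun r => r ^ 2 := by
      filter_upwards [Ioi_mem_nhds h] with x hx
      rw [max_eq_left (Set.mem_Ioi.1 hx).le]
    rw [max_eq_left h.le]
    simpa using (hasDerivAt_pow 2 r).congr_of_eventuallyEq this

lemma hasDerivAt_max_sub_sq (k r : ℝ) :
    HasDerivAt (fun r : ℝ => max (r - k) 0 ^ 2) (2 * max (r - k) 0) r := by
  simpa using (hasDerivAt_max_sq (r - k)).comp_sub_const r k

lemma ae_mem_box (s t : ℝ) : ∀ᵐ p ∂(boxVol s t), p ∈ box s t :=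
  ae_restrict_mem (measurableSet_box s t)

lemma eq_zero_of_integral_box_nonpos {G : ℝ × ℝ → ℝ} (hG : Continuous G) (h0 : ∀ p, 0 ≤ G p)
    {s t : ℝ} (hst : s < t) (hI : ∫ p, G p ∂(boxVol s t) ≤ 0) : ∀ p ∈ box s t, G p = 0 := by
  have h1 : ∫ p, G p ∂(boxVol s t) = 0 := le_antisymm hI (integral_nonneg h0)
  have h2 := (integral_eq_zero_iff_of_nonneg h0 (hG.integrable_box s t)).1 h1
  have hcl : box s t ⊆ closure (interior (box s t)) := by
    rw [box_eq, interior_prod_eq, interior_Icc, interior_Icc, closure_prod_eq,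
      closure_Ioo hst.ne, closure_Ioo zero_ne_one]
  exact Measure.eqOn_of_ae_eq h2 hG.continuousOn continuousOn_const hcl

lemma le_of_fst_eq_zero {P Px Py : ℝ × ℝ → ℝ} (hP : HasGrad P Px Py) {s t k : ℝ} (hst : s < t)
    (hae : ∀ᵐ p ∂(boxVol s t), k < P p → Px p = 0)
    (hs : ∀ y ∈ Set.Icc (0 : ℝ) 1, P (s, y) ≤ k) (ht : ∀ y ∈ Set.Icc (0 : ℝ) 1, P (t, y) ≤ k) :
    ∀ p ∈ box s t, P p ≤ k := by
  have hPc := hP.continuous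
  set φ : ℝ → ℝ := fun r => max (r - k) 0 ^ 2 with hφ
  have hA := (HasGrad.of_fst (φ := fun x => x) (φ' := fun _ => 1) hasDerivAt_id).mul
    (hP.scomp (hasDerivAt_max_sub_sq k))
  have hφc : Continuous fun p => φ (P p) := by fun_prop
  have hae' : (fun p => φ (P p)) =ᵐ[boxVol s t] fun p =>
      1 * max (P p - k) 0 ^ 2 + p.1 * (2 * max (P p - k) 0 * Px p) + 0 := by
    filter_upwards [hae] with p hp
    rcases le_or_gt (P p) k with h | h
    · simp [hφ, max_eq_right (sub_nonpos.2 h)]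
    · simp [hφ, hp h]
  have key := integral_div_box hA (HasGrad.of_const 0) (fun _ _ => rfl) hst.le
    ((hφc.integrable_box s t).congr hae')
  rw [← integral_congr_ae hae'] at key
  have z : ∀ x, (∀ y ∈ Set.Icc (0 : ℝ) 1, P (x, y) ≤ k) →
      ∫ y in (0 : ℝ)..1, x * max (P (x, y) - k) 0 ^ 2 = 0 := fun x hx => by
    rw [intervalIntegral.integral_congr (g := fun _ => 0)]
    · simp
    · intro y hy
      rw [Set.uIcc_of_le zero_le_one] at hy
      simp [max_eq_right (sub_nonpos.2 (hx y hy))]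
  simp only [z s hs, z t ht, sub_zero] at key
  intro p hp
  have := eq_zero_of_integral_box_nonpos hφc (fun p => sq_nonneg _) hst key.le p hp
  have h2 : max (P p - k) 0 = 0 := by simpa [hφ] using this
  linarith [le_max_left (P p - k) 0]

lemma elliptic_aux {B c m r S X Y : ℝ} (hB : 0 ≤ B) (hc : 0 < c) (hm : c ≤ m) (hr : 0 ≤ r)
    (hrc : B ^ 2 * r ≤ c) (hS : |S| ≤ B * (|X| + |Y|)) :
    -2 * ((X + m) ^ 2 + Y ^ 2) - (B + 1) * m * r + S * r ≤ -(c / 2) * r := by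
  have young : ∀ Z : ℝ, B * r * |Z| ≤ Z ^ 2 + (B * r) ^ 2 / 4 := fun Z => by
    nlinarith [sq_nonneg (|Z| - B * r / 2), sq_abs Z]
  have hX : |X| ≤ |X + m| + m := by
    have := abs_sub (X + m) m
    rw [add_sub_cancel_right, abs_of_nonneg (hc.le.trans hm)] at this
    exact this
  have h1 : S * r ≤ B * (|X + m| + m + |Y|) * r := by
    refine mul_le_mul_of_nonneg_right ((le_abs_self S).trans (hS.trans ?_)) hr
    gcongr
  have h2 : c * r ≤ m * r := mul_le_mul_of_nonneg_right hm hr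
  have h3 : B ^ 2 * r * r ≤ c * r := mul_le_mul_of_nonneg_right hrc hr
  have h4 := young (X + m)
  have h5 := young Y
  have h6 := sq_nonneg (X + m)
  have h7 := sq_nonneg Y
  have e1 : B * (|X + m| + m + |Y|) * r = B * r * |X + m| + B * m * r + B * r * |Y| := by ring
  have e2 : (B + 1) * m * r = B * m * r + m * r := by ring
  have e3 : (B * r) ^ 2 = B ^ 2 * r * r := by ring
  rw [e1] at h1
  rw [e3] at h4 h5
  rw [e2]
  linarith

set_option maxHeartbeats 1000000 in
/-- A maximum principle for `-Δ P + S_y = 0`, written as a first-order system in `(P, Q)`,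
where `S_y` is controlled by `∇P`. -/
lemma le_of_elliptic {P Px Py Q Qx Qy S Sx Sy : ℝ × ℝ → ℝ} (hP : HasGrad P Px Py)
    (hQ : HasGrad Q Qx Qy) (hS : HasGrad S Sx Sy) (pP : PerY P) (pQ : PerY Q) (pS : PerY S)
    {s t k : ℝ} (hst : s < t)
    (Px2 : MemLp Px 2 (boxVol s t)) (Py2 : MemLp Py 2 (boxVol s t))
    (Qx2 : MemLp Qx 2 (boxVol s t)) (Qy2 : MemLp Qy 2 (boxVol s t))
    (hdiv : ∀ p, Px p + Qy p = 0) {B : ℝ} (hB0 : 0 ≤ B)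
    (hB : ∀ p ∈ box s t, |Sy p| ≤ B * (|Px p| + |Py p|))
    (hae : ∀ᵐ p ∂(boxVol s t), k < P p → Qx p - Py p = S p)
    (hs : ∀ y ∈ Set.Icc (0 : ℝ) 1, P (s, y) ≤ k) (ht : ∀ y ∈ Set.Icc (0 : ℝ) 1, P (t, y) ≤ k) :
    ∀ p ∈ box s t, P p ≤ k := by
  by_contra! hcon
  obtain ⟨p0, hp0, hk0⟩ := hcon
  set M := P p0
  set l := B + 1 with hl
  set ε := (M - k) / 2 * Real.exp (-(l * t)) with hε
  have hMk : 0 < M - k := sub_pos.2 hk0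
  have hεpos : 0 < ε := by positivity
  have hlpos : 0 < l := by positivity
  have hexp : ∀ c x : ℝ, HasDerivAt (fun x => c * Real.exp (l * x)) (c * l * Real.exp (l * x)) x := by
    intro c x
    have := (((hasDerivAt_id x).const_mul l).exp).const_mul c
    simpa [mul_comm, mul_left_comm, mul_assoc] using this
  have hZ := hP.add (HasGrad.of_fst (hexp ε))
  have hm := HasGrad.of_fst (hexp (-(ε * l)))
  set Z : ℝ × ℝ → ℝ := fun p => P p + ε * Real.exp (l * p.1) with hZdef
  obtain ⟨p1, hp1, hmax⟩ := (isCompact_box s t).exists_isMaxOn ⟨p0, hp0⟩ hZ.continuous.continuousOn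
  set c := ε * l * Real.exp (l * s) with hc
  have hcpos : 0 < c := by positivity
  set κ := max ((M + k) / 2) (Z p1 - c / (B ^ 2 + 1)) with hκ
  have hZp1 : M < Z p1 := by
    have h1 : Z p0 ≤ Z p1 := hmax hp0
    have h2 : M < Z p0 := lt_add_of_pos_right _ (by positivity)
    linarith
  have hκ1 : κ < Z p1 := by
    refine max_lt (by linarith) ?_
    have : 0 < c / (B ^ 2 + 1) := by positivity
    linarith
  have hxle : ∀ x ≤ t, ε * Real.exp (l * x) ≤ (M - k) / 2 := fun x hx => by
    rw [hε, mul_assoc, ← Real.exp_add]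
    have : Real.exp (-(l * t) + l * x) ≤ 1 := Real.exp_le_one_iff.2 (by nlinarith)
    nlinarith
  set r : ℝ × ℝ → ℝ := fun p => max (Z p - κ) 0 with hr
  have hr0 : ∀ p, 0 ≤ r p := fun p => le_max_right _ _
  have hrc : Continuous r := (hZ.continuous.sub continuous_const).max continuous_const
  have hrslice : ∀ x ≤ t, (∀ y ∈ Set.Icc (0 : ℝ) 1, P (x, y) ≤ k) →
      ∀ y ∈ Set.Icc (0 : ℝ) 1, r (x, y) = 0 := by
    intro x hx h y hy
    refine max_eq_right (sub_nonpos.2 ?_)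
    have h1 := hxle x hx
    have h2 := h y hy
    have h3 : (M + k) / 2 ≤ κ := le_max_left _ _
    simp only [hZdef]
    linarith
  have pZ : PerY Z := fun x y => by simp only [hZdef, pP x y]
  have pη : PerY fun p => r p ^ 2 := fun x y => by simp only [hr, pZ x y]
  have slice0 : ∀ x ≤ t, (∀ y ∈ Set.Icc (0 : ℝ) 1, P (x, y) ≤ k) → ∀ y, r (x, y) ^ 2 = 0 := by
    intro x hx h y
    have h1 := hrslice x hx h (Int.fract y) ⟨Int.fract_nonneg y, (Int.fract_lt_one y).le⟩
    have h2 : Function.Periodic (fun y => r (x, y) ^ 2) 1 := fun y => pη x y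
    have h3 := h2.sub_zsmul_eq (x := y) ⌊y⌋
    simp only [zsmul_eq_mul, mul_one] at h3
    rw [← h3]
    have : y - ⌊y⌋ = Int.fract y := rfl
    rw [this, h1]; simp
  have hη := hZ.scomp (hasDerivAt_max_sub_sq κ)
  set m : ℝ × ℝ → ℝ := fun p => ε * l * Real.exp (l * p.1) with hmdef
  have hmc : Continuous m := by fun_prop
  have Zx2 : MemLp (fun p => Px p + m p) 2 (boxVol s t) := Px2.add (hmc.memLp_box s t 2)
  have Zy2 : MemLp (fun p => Py p + 0) 2 (boxVol s t) := by simpa using Py2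
  have h2r : Continuous fun p => 2 * r p := by fun_prop
  have ηx2 : MemLp (fun p => 2 * r p * (Px p + m p)) 2 (boxVol s t) := h2r.memLp_mul_box Zx2
  have ηy2 : MemLp (fun p => 2 * r p * (Py p + 0)) 2 (boxVol s t) := h2r.memLp_mul_box Zy2
  have Sy2 : MemLp Sy 2 (boxVol s t) := by
    refine ((Px2.norm.add Py2.norm).const_mul B).mono' hS.measurable_snd.aestronglyMeasurable ?_
    filter_upwards [ae_mem_box s t] with p hp
    simpa using hB p hp
  have I1 := integral_jacobian_eq_zero hη hQ pη pQ hst.le ηx2 ηy2 Qx2 Qy2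
    (slice0 s hst.le hs) (slice0 t le_rfl ht)
  have pSη : PerY fun p => S p * r p ^ 2 := fun x y => by simp only [pS x y, pη x y]
  have toI : ∀ {g : ℝ × ℝ → ℝ}, MemLp g 2 (boxVol s t) → Integrable g (boxVol s t) := fun h =>
    h.integrable one_le_two
  have hr2 : Continuous fun p => r p ^ 2 := by fun_prop
  have hml : Continuous fun p : ℝ × ℝ => -(ε * l) * l * Real.exp (l * p.1) * r p ^ 2 := by fun_prop
  have hmc' : Continuous fun p : ℝ × ℝ => -(ε * l) * Real.exp (l * p.1) := by fun_prop
  have J2 : Integrable (fun p => (-(ε * l) * l * Real.exp (l * p.1) * r p ^ 2 +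
      -(ε * l) * Real.exp (l * p.1) * (2 * r p * (Px p + m p))) +
      (Sy p * r p ^ 2 + S p * (2 * r p * (Py p + 0)))) (boxVol s t) := by
    refine ((hml.integrable_box s t).add (toI (hmc'.memLp_mul_box ηx2))).add
      (Integrable.add ?_ (toI (hS.continuous.memLp_mul_box ηy2)))
    simpa [mul_comm] using toI (hr2.memLp_mul_box Sy2)
  have I2 := integral_div_box (hm.mul hη) (hS.mul hη) pSη hst.le J2
  simp only [hr] at slice0
  simp only [slice0 s hst.le hs, slice0 t le_rfl ht, mul_zero, intervalIntegral.integral_zero,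
    sub_zero] at I2
  have J1 : Integrable (fun p => 2 * r p * (Px p + m p) * Qy p - 2 * r p * (Py p + 0) * Qx p)
      (boxVol s t) := (integrable_mul_of_sq ηx2 Qy2).sub (integrable_mul_of_sq ηy2 Qx2)
  have I3 := integral_add J1 J2
  have I1' : ∫ p, (2 * r p * (Px p + m p) * Qy p - 2 * r p * (Py p + 0) * Qx p) ∂(boxVol s t) = 0 :=
    I1
  have I2' : ∫ p, ((-(ε * l) * l * Real.exp (l * p.1) * r p ^ 2 +
      -(ε * l) * Real.exp (l * p.1) * (2 * r p * (Px p + m p))) +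
      (Sy p * r p ^ 2 + S p * (2 * r p * (Py p + 0)))) ∂(boxVol s t) = 0 := I2
  rw [I1', I2', add_zero] at I3
  have hle : ∫ p, ((2 * r p * (Px p + m p) * Qy p - 2 * r p * (Py p + 0) * Qx p) +
      ((-(ε * l) * l * Real.exp (l * p.1) * r p ^ 2 +
      -(ε * l) * Real.exp (l * p.1) * (2 * r p * (Px p + m p))) +
      (Sy p * r p ^ 2 + S p * (2 * r p * (Py p + 0))))) ∂(boxVol s t) ≤
      ∫ p, -(c / 2) * r p ^ 2 ∂(boxVol s t) := by
    refine integral_mono_ae (J1.add J2) ((hr2.const_mul _).integrable_box s t) ?_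
    filter_upwards [ae_mem_box s t, hae] with p hp hpe
    have e1 : -(ε * l) * l * Real.exp (l * p.1) = -(l * m p) := by simp only [hmdef]; ring
    have e2 : -(ε * l) * Real.exp (l * p.1) = -m p := by simp only [hmdef]; ring
    rw [e1, e2]
    rcases (hr0 p).eq_or_lt with h0 | hpos
    · simp [← h0]
    have hZκ : κ < Z p := by
      by_contra! hle
      rw [hr] at hpos
      simp only [max_eq_right (sub_nonpos.2 hle), lt_irrefl] at hpos
    rw [box_eq] at hp
    have hkP : k < P p := by
      have h1 := hxle p.1 hp.1.2
      have h3 : (M + k) / 2 ≤ κ := le_max_left _ _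
      simp only [hZdef] at hZκ
      linarith
    have hQx : Qx p = S p + Py p := by linarith [hpe hkP]
    have hQy : Qy p = -Px p := by linarith [hdiv p]
    have hmp : c ≤ m p := by
      simp only [hc, hmdef]
      gcongr
      exact hp.1.1
    have hrle : B ^ 2 * r p ≤ c := by
      have h1 : Z p ≤ Z p1 := hmax (by rw [box_eq]; exact hp)
      have h2 : Z p1 - c / (B ^ 2 + 1) ≤ κ := le_max_right _ _
      have h3 : r p ≤ c / (B ^ 2 + 1) := max_le (by linarith) (by positivity)
      calc B ^ 2 * r p ≤ (B ^ 2 + 1) * r p := by nlinarith [hr0 p]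
        _ ≤ (B ^ 2 + 1) * (c / (B ^ 2 + 1)) := by gcongr
        _ = c := by field_simp
    have hSy : |Sy p| ≤ B * (|Px p| + |Py p|) := hB p (by rw [box_eq]; exact hp)
    rw [hQx, hQy]
    have expand : 2 * r p * (Px p + m p) * -Px p - 2 * r p * (Py p + 0) * (S p + Py p) +
        (-(l * m p) * r p ^ 2 + -m p * (2 * r p * (Px p + m p)) +
          (Sy p * r p ^ 2 + S p * (2 * r p * (Py p + 0)))) =
        r p * (-2 * ((Px p + m p) ^ 2 + Py p ^ 2) - l * m p * r p + Sy p * r p) := by ring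
    rw [expand]
    have hfin := elliptic_aux hB0 hcpos hmp hpos.le hrle hSy
    calc _ ≤ r p * (-(c / 2) * r p) := mul_le_mul_of_nonneg_left hfin hpos.le
      _ = _ := by ring
  rw [I3, integral_const_mul] at hle
  have hzero := eq_zero_of_integral_box_nonpos hr2 (fun p => sq_nonneg _) hst (by nlinarith) p1 hp1
  have : r p1 = 0 := by simpa using hzero
  have h5 : Z p1 - κ ≤ r p1 := le_max_left _ _
  linarith

lemma frequently_lt_of_lintegral_ne_top {A : ℝ → ℝ≥0∞} (hA : Measurable A)
    (hfin : ∫⁻ t, A t ≠ ∞) {l : Filter ℝ} (hl : ∀ s ∈ l, volume s = ∞) {c : ℝ≥0∞} (hc : c ≠ 0) :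
    ∃ᶠ t in l, A t < c := by
  intro h
  have h1 : volume {t | c ≤ A t} = ∞ := hl _ (h.mono fun t ht => not_lt.1 ht)
  have h2 := mul_meas_ge_le_lintegral hA c (μ := volume)
  rw [h1, ENNReal.mul_top hc] at h2
  exact hfin (top_le_iff.1 h2)

lemma volume_eq_top_of_mem_atTop {s : Set ℝ} (hs : s ∈ (atTop : Filter ℝ)) : volume s = ∞ := by
  obtain ⟨T, hT⟩ := mem_atTop_sets.1 hs
  exact top_le_iff.1 ((Real.volume_Ici (a := T)).symm.le.trans (measure_mono hT))

lemma volume_eq_top_of_mem_atBot {s : Set ℝ} (hs : s ∈ (atBot : Filter ℝ)) : volume s = ∞ := by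
  obtain ⟨T, hT⟩ := mem_atBot_sets.1 hs
  exact top_le_iff.1 ((Real.volume_Iic (a := T)).symm.le.trans (measure_mono hT))

lemma integral_sq_le_of_lintegral_lt {φ' : ℝ → ℝ} (hm : Measurable φ') {δ : ℝ}
    (h : ∫⁻ y in Set.Icc (0 : ℝ) 1, ENNReal.ofReal (φ' y ^ 2) < ENNReal.ofReal (δ ^ 2)) :
    IntegrableOn (fun y => φ' y ^ 2) (Set.Icc 0 1) ∧ ∫ y in Set.Icc (0 : ℝ) 1, φ' y ^ 2 ≤ δ ^ 2 := by
  have hi : IntegrableOn (fun y => φ' y ^ 2) (Set.Icc 0 1) :=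
    ⟨(hm.pow_const 2).aestronglyMeasurable, by
      rw [hasFiniteIntegral_iff_ofReal (Eventually.of_forall fun y => sq_nonneg _)]
      exact h.trans ENNReal.ofReal_lt_top⟩
  refine ⟨hi, ?_⟩
  rw [integral_eq_lintegral_of_nonneg_ae (Eventually.of_forall fun y => sq_nonneg _) hi.1]
  exact ENNReal.toReal_le_of_le_ofReal (sq_nonneg δ) h.le

lemma abs_sub_average_le {φ φ' : ℝ → ℝ} (hφ : ∀ y, HasDerivAt φ (φ' y) y) (hm : Measurable φ')
    {δ : ℝ} (hδ : 0 ≤ δ)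
    (h : ∫⁻ y in Set.Icc (0 : ℝ) 1, ENNReal.ofReal (φ' y ^ 2) < ENNReal.ofReal (δ ^ 2)) :
    ∀ y ∈ Set.Icc (0 : ℝ) 1, |φ y - ∫ z in (0 : ℝ)..1, φ z| ≤ δ := by
  obtain ⟨hi2, hle⟩ := integral_sq_le_of_lintegral_lt hm h
  have hi : IntegrableOn φ' (Set.Icc 0 1) :=
    ((memLp_two_iff_integrable_sq hm.aestronglyMeasurable).2 hi2).integrable one_le_two
  have hosc : ∀ z y, 0 ≤ z → z ≤ y → y ≤ 1 → |φ y - φ z| ≤ δ := by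
    intro z y h0 hzy h1
    have hsub : Set.Icc z y ⊆ Set.Icc 0 1 := Set.Icc_subset_Icc h0 h1
    have i1 : IntervalIntegrable φ' volume z y :=
      (intervalIntegrable_iff_integrableOn_Icc_of_le hzy).2 (hi.mono_set hsub)
    have i2 : IntervalIntegrable (fun y => φ' y ^ 2) volume z y :=
      (intervalIntegrable_iff_integrableOn_Icc_of_le hzy).2 (hi2.mono_set hsub)
    have hftc := intervalIntegral.integral_eq_sub_of_hasDerivAt (fun x _ => hφ x) i1
    have hcs := sq_intervalIntegral_le hzy i1 i2
    have hmono : ∫ x in z..y, φ' x ^ 2 ≤ δ ^ 2 := by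
      rw [intervalIntegral.integral_of_le hzy, ← integral_Icc_eq_integral_Ioc]
      exact (setIntegral_mono_set hi2 (Eventually.of_forall fun y => sq_nonneg _)
        hsub.eventuallyLE).trans hle
    have h0' : 0 ≤ ∫ x in z..y, φ' x ^ 2 :=
      intervalIntegral.integral_nonneg hzy fun _ _ => sq_nonneg _
    rw [hftc] at hcs
    exact abs_le_of_sq_le_sq (by nlinarith) hδ
  have hφc : Continuous φ := continuous_iff_continuousAt.2 fun y => (hφ y).continuousAt
  intro y hy
  have : φ y - ∫ z in (0 : ℝ)..1, φ z = ∫ z in (0 : ℝ)..1, (φ y - φ z) := by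
    rw [intervalIntegral.integral_sub (by simp) (hφc.intervalIntegrable _ _)]
    simp
  rw [this]
  have := intervalIntegral.norm_integral_le_of_norm_le_const (a := (0 : ℝ)) (b := 1) (C := δ)
    (f := fun z => φ y - φ z) (fun z hz => by
      rw [Set.uIoc_of_le zero_le_one] at hz
      rw [Real.norm_eq_abs]
      rcases le_total z y with h | h
      · exact hosc z y hz.1.le h hy.2
      · rw [abs_sub_comm]
        exact hosc y z hy.1 h hz.2)
  simpa using this

/-- Along a filter at `±∞`, a map of finite Dirichlet energy whose averages converge has slices
uniformly close to the limit and with small oscillation. -/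
lemma frequently_good_slice {P Px Py Q Qx Qy : ℝ × ℝ → ℝ} (hP : HasGrad P Px Py)
    (hQ : HasGrad Q Qx Qy)
    (hfin : ∫⁻ t, ∫⁻ y in Set.Icc (0 : ℝ) 1,
      ENNReal.ofReal (Py (t, y) ^ 2 + Qy (t, y) ^ 2) ≠ ∞)
    {l : Filter ℝ} (hl : ∀ s ∈ l, volume s = ∞) {a q : ℝ}
    (ha : Tendsto (fun t => ∫ y in (0 : ℝ)..1, P (t, y)) l (𝓝 a))
    (hq : Tendsto (fun t => ∫ y in (0 : ℝ)..1, Q (t, y)) l (𝓝 q)) {δ : ℝ} (hδ : 0 < δ) :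
    ∃ᶠ t in l, (∀ y ∈ Set.Icc (0 : ℝ) 1, |P (t, y) - a| ≤ δ ∧ |Q (t, y) - q| ≤ δ) ∧
      IntegrableOn (fun y => Qy (t, y) ^ 2) (Set.Icc 0 1) ∧
      ∫ y in Set.Icc (0 : ℝ) 1, Qy (t, y) ^ 2 ≤ δ ^ 2 := by
  have hmeas : Measurable fun p : ℝ × ℝ => ENNReal.ofReal (Py p ^ 2 + Qy p ^ 2) :=
    ((hP.measurable_snd.pow_const 2).add (hQ.measurable_snd.pow_const 2)).ennreal_ofReal
  have hA : Measurable fun t => ∫⁻ y in Set.Icc (0 : ℝ) 1,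
      ENNReal.ofReal (Py (t, y) ^ 2 + Qy (t, y) ^ 2) := hmeas.lintegral_prod_right'
  have hfr := frequently_lt_of_lintegral_ne_top hA hfin hl
    (c := ENNReal.ofReal ((δ / 2) ^ 2)) (by
      rw [Ne, ENNReal.ofReal_eq_zero, not_le]; positivity)
  have ha' := (Metric.tendsto_nhds.1 ha) (δ / 2) (half_pos hδ)
  have hq' := (Metric.tendsto_nhds.1 hq) (δ / 2) (half_pos hδ)
  refine (hfr.and_eventually (ha'.and hq')).mono ?_
  rintro t ⟨ht, hta, htq⟩
  rw [Real.dist_eq] at hta htq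
  have hPt : ∫⁻ y in Set.Icc (0 : ℝ) 1, ENNReal.ofReal (Py (t, y) ^ 2) <
      ENNReal.ofReal ((δ / 2) ^ 2) := lt_of_le_of_lt (lintegral_mono fun y =>
        ENNReal.ofReal_le_ofReal (le_add_of_nonneg_right (sq_nonneg _))) ht
  have hQt : ∫⁻ y in Set.Icc (0 : ℝ) 1, ENNReal.ofReal (Qy (t, y) ^ 2) <
      ENNReal.ofReal ((δ / 2) ^ 2) := lt_of_le_of_lt (lintegral_mono fun y =>
        ENNReal.ofReal_le_ofReal (le_add_of_nonneg_left (sq_nonneg _))) ht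
  have mP : Measurable fun y => Py (t, y) := hP.measurable_snd.comp measurable_prodMk_left
  have mQ : Measurable fun y => Qy (t, y) := hQ.measurable_snd.comp measurable_prodMk_left
  have bP := abs_sub_average_le (fun y => hP.hasDerivAt_snd t y) mP (half_pos hδ).le hPt
  have bQ := abs_sub_average_le (fun y => hQ.hasDerivAt_snd t y) mQ (half_pos hδ).le hQt
  obtain ⟨i2, hle⟩ := integral_sq_le_of_lintegral_lt mQ hQt
  refine ⟨fun y hy => ⟨?_, ?_⟩, i2, hle.trans (by nlinarith)⟩
  · have := abs_sub_le (P (t, y)) (∫ y in (0 : ℝ)..1, P (t, y)) a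
    linarith [bP y hy]
  · have := abs_sub_le (Q (t, y)) (∫ y in (0 : ℝ)..1, Q (t, y)) q
    linarith [bQ y hy]

/-- The gap between the energy density and the calibration, up to a null Lagrangian. -/
def defect (c v px py qx : ℝ) : ℝ :=
  1 / 2 * (v - qx - c * py) ^ 2 + 1 / 2 * (1 - c ^ 2) * py ^ 2 + (1 + c) * px ^ 2

lemma defect_nonneg {c : ℝ} (hc : |c| ≤ 1) (v px py qx : ℝ) : 0 ≤ defect c v px py qx := by
  have h := abs_le.1 hc
  have h1 : 0 ≤ 1 - c ^ 2 := by nlinarith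
  have h2 : 0 ≤ 1 + c := by linarith
  unfold defect
  positivity

lemma eq_of_defect_eq_zero {c v px py qx : ℝ} (hc : |c| ≤ 1) (h : defect c v px py qx = 0) :
    v = qx + c * py ∧ (1 - c ^ 2) * py ^ 2 = 0 ∧ (1 + c) * px ^ 2 = 0 := by
  have hc' := abs_le.1 hc
  have h1 : 0 ≤ (1 - c ^ 2) * py ^ 2 := mul_nonneg (by nlinarith) (sq_nonneg _)
  have h2 : 0 ≤ (1 + c) * px ^ 2 := mul_nonneg (by linarith) (sq_nonneg _)
  have h3 := sq_nonneg (v - qx - c * py)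
  unfold defect at h
  refine ⟨?_, by linarith, by linarith⟩
  have : (v - qx - c * py) ^ 2 = 0 := by linarith
  have := pow_eq_zero_iff (two_ne_zero) |>.1 this
  linarith

lemma integrable_sq_add_box {Px Py Qx Qy : ℝ × ℝ → ℝ} {s t : ℝ}
    (Px2 : MemLp Px 2 (boxVol s t)) (Py2 : MemLp Py 2 (boxVol s t))
    (Qx2 : MemLp Qx 2 (boxVol s t)) (Qy2 : MemLp Qy 2 (boxVol s t)) {v : ℝ × ℝ → ℝ}
    (hv : Continuous v) :
    Integrable (fun p => 1 / 2 * (Px p ^ 2 + Py p ^ 2 + Qx p ^ 2 + Qy p ^ 2) + 1 / 2 * v p ^ 2)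
      (boxVol s t) :=
  ((((Px2.integrable_sq.add Py2.integrable_sq).add Qx2.integrable_sq).add
    Qy2.integrable_sq).const_mul _).add ((hv.memLp_box s t 2).integrable_sq.const_mul _)

lemma integrable_defect_box {Px Py Qx : ℝ × ℝ → ℝ} {s t : ℝ}
    (Px2 : MemLp Px 2 (boxVol s t)) (Py2 : MemLp Py 2 (boxVol s t))
    (Qx2 : MemLp Qx 2 (boxVol s t)) {v c : ℝ × ℝ → ℝ}
    (hv : Continuous v) (hc : Continuous c) :
    Integrable (fun p => defect (c p) (v p) (Px p) (Py p) (Qx p)) (boxVol s t) := by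
  have h1 : MemLp (fun p => v p - Qx p - c p * Py p) 2 (boxVol s t) :=
    ((hv.memLp_box s t 2).sub Qx2).sub (hc.memLp_mul_box Py2)
  have c1 : Continuous fun p => 1 / 2 * (1 - c p ^ 2) := by fun_prop
  have c2 : Continuous fun p => 1 + c p := by fun_prop
  have h2 := c1.memLp_mul_box (memLp_one_iff_integrable.2 Py2.integrable_sq)
  have h3 := c2.memLp_mul_box (memLp_one_iff_integrable.2 Px2.integrable_sq)
  exact ((h1.integrable_sq.const_mul (1 / 2)).add (memLp_one_iff_integrable.1 h2)).add
    (memLp_one_iff_integrable.1 h3)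

lemma integral_defect_eq {P Px Py Q Qx Qy : ℝ × ℝ → ℝ} (hP : HasGrad P Px Py)
    (hQ : HasGrad Q Qx Qy) (pP : PerY P) (pQ : PerY Q) {s t : ℝ} (hst : s ≤ t)
    (Px2 : MemLp Px 2 (boxVol s t)) (Py2 : MemLp Py 2 (boxVol s t))
    (Qx2 : MemLp Qx 2 (boxVol s t)) (Qy2 : MemLp Qy 2 (boxVol s t))
    (hdiv : ∀ p, Px p + Qy p = 0) {f : ℝ → ℝ} (hf : Continuous f)
    {w D Φ1 Φ2 : ℝ × ℝ → ℝ} (hw : Continuous w)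
    (h1 : HasGrad Φ1 D w) (h2 : HasGrad Φ2 (fun p => f p.1 * w p) D) :
    ∫ p, defect (f (P p)) (w (P p, Q p)) (Px p) (Py p) (Qx p) ∂(boxVol s t) =
      ∫ p, (1 / 2 * (Px p ^ 2 + Py p ^ 2 + Qx p ^ 2 + Qy p ^ 2) + 1 / 2 * w (P p, Q p) ^ 2)
        ∂(boxVol s t) -
      ((∫ y in (0 : ℝ)..1, Φ1 (P (t, y), Q (t, y))) - ∫ y in (0 : ℝ)..1, Φ1 (P (s, y), Q (s, y))) -
      ∫ p, (f (P p) * Px p * Qy p - f (P p) * Py p * Qx p) ∂(boxVol s t) := by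
  have hPc := hP.continuous
  have hQc := hQ.continuous
  have hv : Continuous fun p => w (P p, Q p) := by fun_prop
  have hc : Continuous fun p => f (P p) := by fun_prop
  have hvc : Continuous fun p => w (P p, Q p) * f (P p) := by fun_prop
  have J : Integrable (fun p => f (P p) * Px p * Qy p - f (P p) * Py p * Qx p) (boxVol s t) :=
    (integrable_mul_of_sq (hc.memLp_mul_box Px2) Qy2).sub
      (integrable_mul_of_sq (hc.memLp_mul_box Py2) Qx2)
  have hdivΦ : ∀ p, (D (P p, Q p) * Px p + w (P p, Q p) * Qx p) +
      (f (P p) * w (P p, Q p) * Py p + D (P p, Q p) * Qy p) =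
      w (P p, Q p) * Qx p + w (P p, Q p) * f (P p) * Py p := fun p => by
    have : Qy p = -Px p := by linarith [hdiv p]
    rw [this]; ring
  have K : Integrable (fun p => w (P p, Q p) * Qx p + w (P p, Q p) * f (P p) * Py p)
      (boxVol s t) := ((hv.memLp_mul_box Qx2).add (hvc.memLp_mul_box Py2)).integrable one_le_two
  have key := integral_div_box (hP.comp2 hQ h1) (hP.comp2 hQ h2)
    (fun x y => by simp only [pP x y, pQ x y]) hst (by simpa only [hdivΦ] using K)
  simp only [hdivΦ] at key
  have I := integrable_sq_add_box Px2 Py2 Qx2 Qy2 hv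
  have hsub := integral_sub (I.sub K) J
  simp only [Pi.sub_apply] at hsub
  rw [← key, ← integral_sub I K, ← hsub]
  refine integral_congr_ae (Eventually.of_forall fun p => ?_)
  have : Qy p = -Px p := by linarith [hdiv p]
  simp only [defect, this]
  ring

/-- A divergence-free map whose energy does not exceed the calibrated value has zero defect. -/
lemma defect_ae_eq_zero {P Px Py Q Qx Qy : ℝ × ℝ → ℝ} (hP : HasGrad P Px Py)
    (hQ : HasGrad Q Qx Qy) (pP : PerY P) (pQ : PerY Q)
    (Px2 : ∀ s t, MemLp Px 2 (boxVol s t)) (Py2 : ∀ s t, MemLp Py 2 (boxVol s t))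
    (Qx2 : ∀ s t, MemLp Qx 2 (boxVol s t)) (Qy2 : ∀ s t, MemLp Qy 2 (boxVol s t))
    (hfin : ∫⁻ t, ∫⁻ y in Set.Icc (0 : ℝ) 1,
      ENNReal.ofReal (Py (t, y) ^ 2 + Qy (t, y) ^ 2) ≠ ∞)
    (hdiv : ∀ p, Px p + Qy p = 0) {f : ℝ → ℝ} (hf : Continuous f) (hfb : ∀ r, |f r| ≤ 1)
    {w D Φ1 Φ2 : ℝ × ℝ → ℝ} (hw : Continuous w)
    (h1 : HasGrad Φ1 D w) (h2 : HasGrad Φ2 (fun p => f p.1 * w p) D) {a qm qp : ℝ}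
    (ham : Tendsto (fun t => ∫ y in (0 : ℝ)..1, P (t, y)) atBot (𝓝 a))
    (hap : Tendsto (fun t => ∫ y in (0 : ℝ)..1, P (t, y)) atTop (𝓝 a))
    (hqm : Tendsto (fun t => ∫ y in (0 : ℝ)..1, Q (t, y)) atBot (𝓝 qm))
    (hqp : Tendsto (fun t => ∫ y in (0 : ℝ)..1, Q (t, y)) atTop (𝓝 qp))
    (hE : ∀ s t, ∫ p, (1 / 2 * (Px p ^ 2 + Py p ^ 2 + Qx p ^ 2 + Qy p ^ 2) +
      1 / 2 * w (P p, Q p) ^ 2) ∂(boxVol s t) ≤ Φ1 (a, qp) - Φ1 (a, qm)) (s t : ℝ) :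
    ∀ᵐ p ∂(boxVol s t), w (P p, Q p) = Qx p + f (P p) * Py p ∧
      (1 - f (P p) ^ 2) * Py p ^ 2 = 0 ∧ (1 + f (P p)) * Px p ^ 2 = 0 := by
  have hPc := hP.continuous
  have hQc := hQ.continuous
  have hv : Continuous fun p => w (P p, Q p) := by fun_prop
  have hc : Continuous fun p => f (P p) := by fun_prop
  have hdi : ∀ s t, Integrable (fun p => defect (f (P p)) (w (P p, Q p)) (Px p) (Py p) (Qx p))
      (boxVol s t) := fun s t => integrable_defect_box (Px2 s t) (Py2 s t) (Qx2 s t) hv hc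
  have hd0 : ∀ p, 0 ≤ defect (f (P p)) (w (P p, Q p)) (Px p) (Py p) (Qx p) := fun p =>
    defect_nonneg (hfb _) _ _ _ _
  set F : ℝ → ℝ := fun x => ∫ r in (0 : ℝ)..x, f r with hF
  have hF' : ∀ r, HasDerivAt F (f r) r := fun r => hf.integral_hasStrictDerivAt 0 r |>.hasDerivAt
  have hFc : Continuous F := continuous_iff_continuousAt.2 fun r => (hF' r).continuousAt
  have hFP := hP.scomp hF'
  have pFP : PerY fun p => F (P p) := fun x y => by simp only [pP x y]
  have hsmall : ∀ ε > 0, ∫ p, defect (f (P p)) (w (P p, Q p)) (Px p) (Py p) (Qx p) ∂(boxVol s t)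
      ≤ ε := by
    intro ε hε
    obtain ⟨ηm, hηm, hm⟩ := Metric.continuousAt_iff.1 (h1.continuous.continuousAt (x := (a, qm)))
      (ε / 4) (by positivity)
    obtain ⟨ηp, hηp, hp⟩ := Metric.continuousAt_iff.1 (h1.continuous.continuousAt (x := (a, qp)))
      (ε / 4) (by positivity)
    obtain ⟨C, hC⟩ := (isCompact_Icc (a := a - 1) (b := a + 1)).exists_bound_of_continuousOn
      hFc.continuousOn
    have hC0 : 0 ≤ C := (norm_nonneg _).trans (hC a ⟨by linarith, by linarith⟩)
    obtain ⟨δ, hδ0, hδ1, hδm, hδp, hδC⟩ : ∃ δ > 0, δ ≤ 1 ∧ δ < ηm ∧ δ < ηp ∧ 2 * C * δ ≤ ε / 2 := by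
      refine ⟨min (min 1 (ηm / 2)) (min (ηp / 2) (ε / 2 / (2 * C + 1))), by positivity,
        (min_le_left _ _).trans (min_le_left _ _),
        ((min_le_left _ _).trans (min_le_right _ _)).trans_lt (half_lt_self hηm),
        ((min_le_right _ _).trans (min_le_left _ _)).trans_lt (half_lt_self hηp), ?_⟩
      have hle : min (min 1 (ηm / 2)) (min (ηp / 2) (ε / 2 / (2 * C + 1))) ≤ ε / 2 / (2 * C + 1) :=
        (min_le_right _ _).trans (min_le_right _ _)
      calc _ ≤ 2 * C * (ε / 2 / (2 * C + 1)) := by gcongr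
        _ ≤ (2 * C + 1) * (ε / 2 / (2 * C + 1)) := by gcongr; linarith
        _ = ε / 2 := by field_simp
    obtain ⟨t', ⟨ht1, ht2, ht3⟩, htt⟩ := ((frequently_good_slice hP hQ hfin
      (fun _ => volume_eq_top_of_mem_atTop) hap hqp hδ0).and_eventually
      (eventually_ge_atTop (max s t))).exists
    obtain ⟨s', ⟨hs1, hs2, hs3⟩, hss⟩ := ((frequently_good_slice hP hQ hfin
      (fun _ => volume_eq_top_of_mem_atBot) ham hqm hδ0).and_eventually
      (eventually_le_atBot (min s t))).exists
    have hst' : s' ≤ t' := hss.trans ((min_le_left _ _).trans ((le_max_left _ _).trans htt))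
    have hslice : ∀ x q, (∀ y ∈ Set.Icc (0 : ℝ) 1, |P (x, y) - a| ≤ δ ∧ |Q (x, y) - q| ≤ δ) →
        ∀ η, δ < η → (∀ ⦃z : ℝ × ℝ⦄, dist z (a, q) < η → dist (Φ1 z) (Φ1 (a, q)) < ε / 4) →
        |(∫ y in (0 : ℝ)..1, Φ1 (P (x, y), Q (x, y))) - Φ1 (a, q)| ≤ ε / 4 := by
      intro x q hx η hη hz
      have hΦc : Continuous fun y => Φ1 (P (x, y), Q (x, y)) := by
        have := h1.continuous
        fun_prop
      have : (∫ y in (0 : ℝ)..1, Φ1 (P (x, y), Q (x, y))) - Φ1 (a, q) =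
          ∫ y in (0 : ℝ)..1, (Φ1 (P (x, y), Q (x, y)) - Φ1 (a, q)) := by
        rw [intervalIntegral.integral_sub (hΦc.intervalIntegrable _ _) (by simp)]
        simp
      rw [this]
      have := intervalIntegral.norm_integral_le_of_norm_le_const (a := (0 : ℝ)) (b := 1)
        (C := ε / 4) (f := fun y => Φ1 (P (x, y), Q (x, y)) - Φ1 (a, q)) (fun y hy => by
          rw [Set.uIoc_of_le zero_le_one] at hy
          have hb := hx y ⟨hy.1.le, hy.2⟩
          refine (hz ?_).le
          rw [Prod.dist_eq]
          exact (max_le hb.1 hb.2).trans_lt hη)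
      simpa using this
    have bm := abs_le.1 (hslice s' qm hs1 ηm hδm hm)
    have bp := abs_le.1 (hslice t' qp ht1 ηp hδp hp)
    have hCb : ∀ x q, (∀ y ∈ Set.Icc (0 : ℝ) 1, |P (x, y) - a| ≤ δ ∧ |Q (x, y) - q| ≤ δ) →
        ∀ y ∈ Set.Icc (0 : ℝ) 1, |F (P (x, y))| ≤ C := fun x q hx y hy => by
      have := abs_le.1 (hx y hy).1
      exact hC _ ⟨by linarith, by linarith⟩
    have hJ := abs_integral_jacobian_le hFP hQ pFP pQ hst' (hc.memLp_mul_box (Px2 _ _))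
      (hc.memLp_mul_box (Py2 _ _)) (Qx2 _ _) (Qy2 _ _) hδ0 (hCb s' qm hs1) (hCb t' qp ht1)
      hs2 ht2 hs3 ht3
    have hid := integral_defect_eq hP hQ pP pQ hst' (Px2 _ _) (Py2 _ _) (Qx2 _ _) (Qy2 _ _)
      hdiv hf hw h1 h2
    have hmono : ∫ p, defect (f (P p)) (w (P p, Q p)) (Px p) (Py p) (Qx p) ∂(boxVol s t) ≤
        ∫ p, defect (f (P p)) (w (P p, Q p)) (Px p) (Py p) (Qx p) ∂(boxVol s' t') := by
      refine setIntegral_mono_set (hdi s' t') (Eventually.of_forall hd0)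
        (LE.le.eventuallyLE ?_)
      rw [box_eq, box_eq]
      exact Set.prod_mono (Set.Icc_subset_Icc (hss.trans (min_le_left _ _))
        ((le_max_right _ _).trans htt)) subset_rfl
    have hJ' := (abs_le.1 hJ).1
    have hE' := hE s' t'
    linarith [bm.1, bm.2, bp.1, bp.2]
  have hle0 : ∫ p, defect (f (P p)) (w (P p, Q p)) (Px p) (Py p) (Qx p) ∂(boxVol s t) ≤ 0 :=
    _root_.le_of_forall_pos_le_add fun ε hε => by simpa using hsmall ε hε
  have hzero := le_antisymm hle0 (integral_nonneg hd0)
  filter_upwards [(integral_eq_zero_iff_of_nonneg hd0 (hdi s t)).1 hzero] with p hp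
  exact eq_of_defect_eq_zero (hfb _) hp

lemma mul_le_of_defect_eq_zero {P Px Py Q Qx Qy : ℝ × ℝ → ℝ} (hP : HasGrad P Px Py)
    (hQ : HasGrad Q Qx Qy) (pP : PerY P) (pQ : PerY Q) {s t : ℝ} (hst : s < t)
    (Px2 : MemLp Px 2 (boxVol s t)) (Py2 : MemLp Py 2 (boxVol s t))
    (Qx2 : MemLp Qx 2 (boxVol s t)) (Qy2 : MemLp Qy 2 (boxVol s t))
    (hdiv : ∀ p, Px p + Qy p = 0) {f : ℝ → ℝ} (hf : Continuous f)
    {w w1 w2 : ℝ × ℝ → ℝ} (hw : HasGrad w w1 w2) (hw1 : Continuous w1) (hw2 : Continuous w2)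
    (hd : ∀ᵐ p ∂(boxVol s t), w (P p, Q p) = Qx p + f (P p) * Py p ∧
      (1 - f (P p) ^ 2) * Py p ^ 2 = 0 ∧ (1 + f (P p)) * Px p ^ 2 = 0)
    {τ : ℝ} (hτ : τ * τ = 1) {k : ℝ}
    (hs : ∀ y ∈ Set.Icc (0 : ℝ) 1, τ * P (s, y) ≤ k)
    (ht : ∀ y ∈ Set.Icc (0 : ℝ) 1, τ * P (t, y) ≤ k) : ∀ p ∈ box s t, τ * P p ≤ k := by
  have hPc := hP.continuous
  have hQc := hQ.continuous
  by_contra! hcon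
  obtain ⟨p0, hp0, hk0⟩ := hcon
  obtain ⟨p1, hp1, hmax⟩ := (isCompact_box s t).exists_isMaxOn ⟨p0, hp0⟩
    (f := fun p => τ * P p) (by fun_prop)
  have hM : k < τ * P p1 := hk0.trans_le (hmax hp0)
  have hττ : ∀ r, τ * (τ * r) = r := fun r => by rw [← mul_assoc, hτ, one_mul]
  have near : ∀ v, f (P p1) ≠ v → ∃ k', k ≤ k' ∧ k' < τ * P p1 ∧
      ∀ p ∈ box s t, k' < τ * P p → f (P p) ≠ v := by
    intro v hv
    have hopen : ∀ᶠ r in 𝓝 (τ * P p1), f (τ * r) ≠ v := by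
      refine ContinuousAt.eventually_ne (by fun_prop) ?_
      rwa [hττ]
    obtain ⟨η, hη, hη'⟩ := Metric.eventually_nhds_iff.1 hopen
    refine ⟨max k (τ * P p1 - η / 2), le_max_left _ _, max_lt hM (by linarith), ?_⟩
    intro p hp hkp
    have h1 : τ * P p ≤ τ * P p1 := hmax hp
    have h2 := (le_max_right _ _).trans_lt hkp
    have := hη' (y := τ * P p) (by
      rw [Real.dist_eq, abs_sub_lt_iff]
      constructor <;> linarith)
    rwa [hττ] at this
  have hτ0 : τ ≠ 0 := fun h => by simp [h] at hτ
  by_cases hcase : f (P p1) = -1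
  · obtain ⟨k', hkk', hk'M, hk'⟩ := near 1 (by rw [hcase]; norm_num)
    obtain ⟨B, hB⟩ := (isCompact_box s t).exists_bound_of_continuousOn
      (f := fun p => |w1 (P p, Q p)| + |w2 (P p, Q p)|) (by fun_prop)
    have hB' : ∀ p ∈ box s t, |w1 (P p, Q p)| + |w2 (P p, Q p)| ≤ B := fun p hp =>
      (le_abs_self _).trans (hB p hp)
    have hB0 : 0 ≤ B := (by positivity : (0 : ℝ) ≤ _).trans (hB' p1 hp1)
    have habsτ : |τ| = 1 := by
      have : |τ| * |τ| = 1 := by rw [← abs_mul, hτ, abs_one]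
      nlinarith [abs_nonneg τ]
    have hle := le_of_elliptic (hP.const_mul τ) (hQ.const_mul τ) ((hP.comp2 hQ hw).const_mul τ)
      (fun x y => by simp only [pP x y]) (fun x y => by simp only [pQ x y])
      (fun x y => by simp only [pP x y, pQ x y]) hst
      (Px2.const_mul τ) (Py2.const_mul τ) (Qx2.const_mul τ) (Qy2.const_mul τ)
      (fun p => by rw [← mul_add, hdiv, mul_zero]) hB0 (k := k')
      (by
        intro p hp
        have hQy : |Qy p| = |Px p| := by
          rw [show Qy p = -Px p by linarith [hdiv p], abs_neg]
        simp only [abs_mul, habsτ, one_mul]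
        have h1 := abs_add_le (w1 (P p, Q p) * Py p) (w2 (P p, Q p) * Qy p)
        rw [abs_mul, abs_mul, hQy] at h1
        have h2 := hB' p hp
        have h3 := abs_nonneg (w1 (P p, Q p))
        have h4 := abs_nonneg (w2 (P p, Q p))
        have h5 : |w1 (P p, Q p)| * |Py p| ≤ B * |Py p| :=
          mul_le_mul_of_nonneg_right (by linarith) (abs_nonneg _)
        have h6 : |w2 (P p, Q p)| * |Px p| ≤ B * |Px p| :=
          mul_le_mul_of_nonneg_right (by linarith) (abs_nonneg _)
        linarith)
      (by
        filter_upwards [ae_mem_box s t, hd] with p hp hdp hkp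
        obtain ⟨h1, h2, -⟩ := hdp
        have hne : 1 - f (P p) ≠ 0 := fun h => hk' p hp hkp (by linarith)
        have h3 : (1 + f (P p)) * Py p = 0 := by
          have : (1 - f (P p)) * ((1 + f (P p)) * Py p * Py p) = 0 := by linear_combination h2
          have := (mul_eq_zero.1 this).resolve_left hne
          rcases mul_eq_zero.1 this with h | h
          · exact h
          · rw [h, mul_zero]
        rw [h1]
        linear_combination (-τ) * h3)
      (fun y hy => (hs y hy).trans hkk') (fun y hy => (ht y hy).trans hkk') p1 hp1
    linarith
  · obtain ⟨k', hkk', hk'M, hk'⟩ := near (-1) hcase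
    have hle := le_of_fst_eq_zero (hP.const_mul τ) (k := k') hst (by
      filter_upwards [ae_mem_box s t, hd] with p hp hdp hkp
      have hne : 1 + f (P p) ≠ 0 := fun h => hk' p hp hkp (by linarith)
      have := (mul_eq_zero.1 hdp.2.2).resolve_left hne
      rw [pow_eq_zero_iff two_ne_zero |>.1 this, mul_zero])
      (fun y hy => (hs y hy).trans hkk') (fun y hy => (ht y hy).trans hkk') p1 hp1
    linarith

/-- A calibrated divergence-free map takes values in the line `{z₁ = a}`. -/
theorem fst_eq_of_calibrated {P Px Py Q Qx Qy : ℝ × ℝ → ℝ} (hP : HasGrad P Px Py)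
    (hQ : HasGrad Q Qx Qy) (pP : PerY P) (pQ : PerY Q)
    (Px2 : ∀ s t, MemLp Px 2 (boxVol s t)) (Py2 : ∀ s t, MemLp Py 2 (boxVol s t))
    (Qx2 : ∀ s t, MemLp Qx 2 (boxVol s t)) (Qy2 : ∀ s t, MemLp Qy 2 (boxVol s t))
    (hfin : ∫⁻ t, ∫⁻ y in Set.Icc (0 : ℝ) 1,
      ENNReal.ofReal (Py (t, y) ^ 2 + Qy (t, y) ^ 2) ≠ ∞)
    (hdiv : ∀ p, Px p + Qy p = 0) {f : ℝ → ℝ} (hf : Continuous f) (hfb : ∀ r, |f r| ≤ 1)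
    {w w1 w2 D Φ1 Φ2 : ℝ × ℝ → ℝ} (hw : HasGrad w w1 w2) (hw1 : Continuous w1)
    (hw2 : Continuous w2)
    (h1 : HasGrad Φ1 D w) (h2 : HasGrad Φ2 (fun p => f p.1 * w p) D) {a qm qp : ℝ}
    (ham : Tendsto (fun t => ∫ y in (0 : ℝ)..1, P (t, y)) atBot (𝓝 a))
    (hap : Tendsto (fun t => ∫ y in (0 : ℝ)..1, P (t, y)) atTop (𝓝 a))
    (hqm : Tendsto (fun t => ∫ y in (0 : ℝ)..1, Q (t, y)) atBot (𝓝 qm))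
    (hqp : Tendsto (fun t => ∫ y in (0 : ℝ)..1, Q (t, y)) atTop (𝓝 qp))
    (hE : ∀ s t, ∫ p, (1 / 2 * (Px p ^ 2 + Py p ^ 2 + Qx p ^ 2 + Qy p ^ 2) +
      1 / 2 * w (P p, Q p) ^ 2) ∂(boxVol s t) ≤ Φ1 (a, qp) - Φ1 (a, qm)) (p : ℝ × ℝ) :
    P p = a := by
  have hd := defect_ae_eq_zero hP hQ pP pQ Px2 Py2 Qx2 Qy2 hfin hdiv hf hfb hw.continuous h1 h2
    ham hap hqm hqp hE
  have main : ∀ x y, y ∈ Set.Icc (0 : ℝ) 1 → P (x, y) = a := by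
    intro x y hy
    have hle : ∀ δ > 0, |P (x, y) - a| ≤ δ := by
      intro δ hδ
      obtain ⟨t, ⟨ht, -, -⟩, hxt⟩ := ((frequently_good_slice hP hQ hfin
        (fun _ => volume_eq_top_of_mem_atTop) hap hqp hδ).and_eventually
        (eventually_gt_atTop x)).exists
      obtain ⟨s, ⟨hs, -, -⟩, hxs⟩ := ((frequently_good_slice hP hQ hfin
        (fun _ => volume_eq_top_of_mem_atBot) ham hqm hδ).and_eventually
        (eventually_lt_atBot x)).exists
      have hmem : (x, y) ∈ box s t := by
        rw [box_eq]
        exact ⟨⟨hxs.le, hxt.le⟩, hy⟩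
      have hup := mul_le_of_defect_eq_zero hP hQ pP pQ (hxs.trans hxt) (Px2 _ _) (Py2 _ _)
        (Qx2 _ _) (Qy2 _ _) hdiv hf hw hw1 hw2 (hd s t) (τ := 1) (k := a + δ) (by norm_num)
        (fun y hy => by linarith [(abs_le.1 (hs y hy).1).2])
        (fun y hy => by linarith [(abs_le.1 (ht y hy).1).2]) _ hmem
      have hdown := mul_le_of_defect_eq_zero hP hQ pP pQ (hxs.trans hxt) (Px2 _ _) (Py2 _ _)
        (Qx2 _ _) (Qy2 _ _) hdiv hf hw hw1 hw2 (hd s t) (τ := -1) (k := -a + δ) (by norm_num)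
        (fun y hy => by linarith [(abs_le.1 (hs y hy).1).1])
        (fun y hy => by linarith [(abs_le.1 (ht y hy).1).1]) _ hmem
      exact abs_le.2 ⟨by linarith, by linarith⟩
    have : |P (x, y) - a| ≤ 0 := _root_.le_of_forall_pos_le_add fun ε hε => by
      simpa using hle ε hε
    linarith [abs_nonpos_iff.1 this]
  have hper : Function.Periodic (fun y => P (p.1, y)) 1 := fun y => pP p.1 y
  have h3 := hper.sub_zsmul_eq (x := p.2) ⌊p.2⌋
  simp only [zsmul_eq_mul, mul_one] at h3
  have h4 := main p.1 (Int.fract p.2) ⟨Int.fract_nonneg _, (Int.fract_lt_one _).le⟩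
  exact h3.symm.trans h4

/-- A closed differentiable vector field on the plane has a potential. -/
lemma exists_hasGrad {A A1 B B2 C : ℝ × ℝ → ℝ} (hA : HasGrad A A1 C) (hB : HasGrad B C B2) :
    ∃ D, HasGrad D A B := by
  set ω : ℝ × ℝ → ℝ × ℝ →L[ℝ] ℝ := fun p =>
    A p • ContinuousLinearMap.fst ℝ ℝ ℝ + B p • ContinuousLinearMap.snd ℝ ℝ ℝ
  have hω : ∀ p, HasFDerivAt ω
      ((A1 p • ContinuousLinearMap.fst ℝ ℝ ℝ + C p • ContinuousLinearMap.snd ℝ ℝ ℝ).smulRight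
        (ContinuousLinearMap.fst ℝ ℝ ℝ) +
      (C p • ContinuousLinearMap.fst ℝ ℝ ℝ + B2 p • ContinuousLinearMap.snd ℝ ℝ ℝ).smulRight
        (ContinuousLinearMap.snd ℝ ℝ ℝ)) p := fun p => by
    have e1 := (hA p).smul_const (ContinuousLinearMap.fst ℝ ℝ ℝ)
    have e2 := (hB p).smul_const (ContinuousLinearMap.snd ℝ ℝ ℝ)
    exact e1.add e2
  obtain ⟨D, hD⟩ := (convex_univ (𝕜 := ℝ) (E := ℝ × ℝ)).exists_forall_hasFDerivAt_of_fderiv_symmetric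
    isOpen_univ (ω := ω) (fun p _ => (hω p).differentiableAt.differentiableWithinAt) (by
      intro p _ x y
      rw [(hω p).fderiv]
      simp
      ring)
  exact ⟨D, fun p => hD p (Set.mem_univ p)⟩

/-- The point of `ℝ²` (as `Fin 2 → ℝ`) with the given pair of coordinates. -/
def toFin (p : ℝ × ℝ) : Fin 2 → ℝ := ![p.1, p.2]

lemma hasFDerivAt_toFin (p : ℝ × ℝ) :
    HasFDerivAt toFin ((ContinuousLinearEquiv.finTwoArrow ℝ ℝ).symm : ℝ × ℝ →L[ℝ] Fin 2 → ℝ) p :=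
  (ContinuousLinearEquiv.finTwoArrow ℝ ℝ).symm.hasFDerivAt

lemma finTwoArrow_symm_apply (p : ℝ × ℝ) :
    (ContinuousLinearEquiv.finTwoArrow ℝ ℝ).symm p =
      p.1 • Pi.single (0 : Fin 2) (1 : ℝ) + p.2 • Pi.single (1 : Fin 2) (1 : ℝ) := by
  ext i
  fin_cases i <;> simp

lemma hasGrad_comp_toFin {g : (Fin 2 → ℝ) → ℝ} (hg : Differentiable ℝ g) :
    HasGrad (fun p => g (toFin p)) (fun p => pdS 0 g (toFin p)) (fun p => pdS 1 g (toFin p)) := by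
  intro p
  refine ((hg (toFin p)).hasFDerivAt.comp p (hasFDerivAt_toFin p)).congr_fderiv ?_
  refine ContinuousLinearMap.ext fun v => ?_
  simp [finTwoArrow_symm_apply, pdS, mul_comm]

lemma contDiff_pdS {w : (Fin 2 → ℝ) → ℝ} (hw : ContDiff ℝ 2 w) (i : Fin 2) :
    ContDiff ℝ 1 (pdS i w) := by
  have : ContDiff ℝ 1 (fderiv ℝ w) := hw.fderiv_right (by norm_num)
  exact this.clm_apply contDiff_const

/-- The potentials attached to a solution of the Tricomi equation. -/
lemma exists_tricomi_potentials {w : (Fin 2 → ℝ) → ℝ} (hw : ContDiff ℝ 2 w) {f : ℝ → ℝ}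
    (hf : ContDiff ℝ 1 f)
    (heq : ∀ z : Fin 2 → ℝ, pdS 0 (pdS 0 w) z - f (z 0) * pdS 1 (pdS 1 w) z = 0) :
    ∃ D Φ1 Φ2 : ℝ × ℝ → ℝ, HasGrad Φ1 D (fun p => w (toFin p)) ∧
      HasGrad Φ2 (fun p => f p.1 * w (toFin p)) D := by
  have h0 := hasGrad_comp_toFin (hw.differentiable two_ne_zero)
  have h1 := hasGrad_comp_toFin ((contDiff_pdS hw 0).differentiable one_ne_zero)
  have h2 := hasGrad_comp_toFin ((contDiff_pdS hw 1).differentiable one_ne_zero)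
  have hF : HasGrad (fun p => f p.1) (fun p => deriv f p.1) (fun _ => 0) :=
    HasGrad.of_fst fun r => (hf.differentiable one_ne_zero r).hasDerivAt
  obtain ⟨D, hD⟩ := exists_hasGrad (hF.mul h2) (h1.congr (gx' := fun p =>
    0 * pdS 1 w (toFin p) + f p.1 * pdS 1 (pdS 1 w) (toFin p)) (fun p => by
      have := heq (toFin p)
      rw [show toFin p 0 = p.1 from rfl] at this
      linarith) fun p => rfl)
  obtain ⟨Φ1, hΦ1⟩ := exists_hasGrad hD h0
  obtain ⟨Φ2, hΦ2⟩ := exists_hasGrad (hF.mul h0) (hD.congr (gx' := fun p =>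
    0 * w (toFin p) + f p.1 * pdS 1 w (toFin p)) (fun p => by ring) fun p => rfl)
  exact ⟨D, Φ1, Φ2, hΦ1, hΦ2⟩

lemma exists_lipschitzOnWith_Icc {φ : ℝ → ℝ} (hφ : ContDiff ℝ 1 φ) (a b : ℝ) :
    ∃ K, LipschitzOnWith K φ (Set.Icc a b) :=
  (hφ.locallyLipschitz.locallyLipschitzOn (s := Set.Icc a b)).exists_lipschitzOnWith_of_compact
    isCompact_Icc

/-- An autonomous scalar equation with equilibria `0 < 1` and positive speed between them has a
heteroclinic orbit. -/
lemma exists_heteroclinic_unit {φ : ℝ → ℝ} (hφ : ContDiff ℝ 1 φ) (h0 : φ 0 = 0) (h1 : φ 1 = 0)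
    (hpos : ∀ s ∈ Set.Ioo (0 : ℝ) 1, 0 < φ s) :
    ∃ s : ℝ → ℝ, (∀ t, HasDerivAt s (φ (s t)) t) ∧ Tendsto s atBot (𝓝 0) ∧
      Tendsto s atTop (𝓝 1) := by
  obtain ⟨K, hK⟩ := exists_lipschitzOnWith_Icc hφ 0 1
  set L : ℝ := 2 * K + 1 with hL
  have hLpos : 0 < L := by positivity
  have hbound : ∀ s ∈ Set.Ioo (0 : ℝ) 1, φ s ≤ L * (s * (1 - s)) := by
    intro s hs
    have e0 := hK.dist_le_mul s ⟨hs.1.le, hs.2.le⟩ 0 ⟨le_rfl, zero_le_one⟩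
    have e1 := hK.dist_le_mul s ⟨hs.1.le, hs.2.le⟩ 1 ⟨zero_le_one, le_rfl⟩
    rw [Real.dist_eq, Real.dist_eq, h0, sub_zero, sub_zero, abs_of_pos hs.1] at e0
    rw [Real.dist_eq, Real.dist_eq, h1, sub_zero, abs_sub_comm, abs_of_pos (sub_pos.2 hs.2)] at e1
    have e0' := (le_abs_self _).trans e0
    have e1' := (le_abs_self _).trans e1
    have hK0 : (0 : ℝ) ≤ K := K.2
    have hs1 : 0 < 1 - s := sub_pos.2 hs.2
    have hss : 0 < s * (1 - s) := mul_pos hs.1 hs1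
    rcases le_total s (1 / 2) with h | h
    · have : (K : ℝ) * s ≤ 2 * K * (s * (1 - s)) := by
        nlinarith [mul_nonneg (mul_nonneg hK0 hs.1.le) (by linarith : (0 : ℝ) ≤ 1 / 2 - s)]
      rw [hL]; nlinarith
    · have : (K : ℝ) * (1 - s) ≤ 2 * K * (s * (1 - s)) := by
        nlinarith [mul_nonneg (mul_nonneg hK0 hs1.le) (by linarith : (0 : ℝ) ≤ s - 1 / 2)]
      rw [hL]; nlinarith
  have hmem : ∀ x, Real.sigmoid x ∈ Set.Ioo (0 : ℝ) 1 := fun x =>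
    ⟨Real.sigmoid_pos x, Real.sigmoid_lt_one x⟩
  set k : ℝ → ℝ := fun x =>
    Real.sigmoid x * (1 - Real.sigmoid x) / φ (Real.sigmoid x) with hk
  have hkc : Continuous k := by
    refine Continuous.div ?_ (hφ.continuous.comp continuous_sigmoid) fun x => (hpos _ (hmem x)).ne'
    exact continuous_sigmoid.mul (continuous_const.sub continuous_sigmoid)
  have hk_ge : ∀ x, L⁻¹ ≤ k x := fun x => by
    rw [hk, inv_eq_one_div, div_le_div_iff₀ hLpos (hpos _ (hmem x)), one_mul, mul_comm]
    exact hbound _ (hmem x)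
  have hk_pos : ∀ x, 0 < k x := fun x => (inv_pos.2 hLpos).trans_le (hk_ge x)
  set H : ℝ → ℝ := fun x => ∫ r in (0 : ℝ)..x, k r with hH
  have hH' : ∀ x, HasDerivAt H (k x) x := fun x => (hkc.integral_hasStrictDerivAt 0 x).hasDerivAt
  have hHmono : StrictMono H := strictMono_of_hasDerivAt_pos hH' hk_pos
  have hHcont : Continuous H := continuous_iff_continuousAt.2 fun x => (hH' x).continuousAt
  have hmono2 : Monotone fun x => H x - L⁻¹ * x := by
    refine monotone_of_hasDerivAt_nonneg (f' := fun x => k x - L⁻¹ * 1)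
      (fun x => (hH' x).sub ((hasDerivAt_id x).const_mul L⁻¹)) fun x => ?_
    simpa using hk_ge x
  have hH0 : H 0 = 0 := by simp [hH]
  have hHtop : Tendsto H atTop atTop := by
    refine tendsto_atTop_mono' atTop ?_ (tendsto_id.const_mul_atTop (inv_pos.2 hLpos))
    filter_upwards [eventually_ge_atTop 0] with x hx
    have := hmono2 hx
    simp only [hH0] at this
    simp only [id]
    linarith
  have hHbot : Tendsto H atBot atBot := by
    refine tendsto_atBot_mono' atBot ?_ (tendsto_id.const_mul_atBot (inv_pos.2 hLpos))
    filter_upwards [eventually_le_atBot 0] with x hx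
    have := hmono2 hx
    simp only [hH0] at this
    simp only [id]
    linarith
  set e := hHmono.orderIsoOfSurjective H (hHcont.surjective hHtop hHbot) with he
  have heH : ∀ t, H (e.symm t) = t := fun t => e.apply_symm_apply t
  have hder : ∀ t, HasDerivAt e.symm (k (e.symm t))⁻¹ t := fun t =>
    (hH' (e.symm t)).of_local_left_inverse e.symm.continuous.continuousAt (hk_pos _).ne'
      (Eventually.of_forall heH)
  refine ⟨fun t => Real.sigmoid (e.symm t), fun t => ?_, ?_, ?_⟩
  · have := (Real.hasDerivAt_sigmoid (e.symm t)).comp t (hder t)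
    have h2 := (hmem (e.symm t)).1.ne'
    have h3 := (sub_pos.2 (hmem (e.symm t)).2).ne'
    have h4 : Real.sigmoid (e.symm t) * (1 - Real.sigmoid (e.symm t)) * (k (e.symm t))⁻¹ =
        φ (Real.sigmoid (e.symm t)) := by
      rw [show k (e.symm t) = Real.sigmoid (e.symm t) * (1 - Real.sigmoid (e.symm t)) /
        φ (Real.sigmoid (e.symm t)) from rfl, inv_div, mul_div_cancel₀ _ (mul_ne_zero h2 h3)]
    rw [h4] at this
    exact this
  · exact Real.tendsto_sigmoid_atBot.comp e.symm.tendsto_atBot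
  · exact Real.tendsto_sigmoid_atTop.comp e.symm.tendsto_atTop

lemma exists_heteroclinic {q : ℝ → ℝ} (hq : ContDiff ℝ 1 q) {m p : ℝ} (hne : m ≠ p)
    (hm : q m = 0) (hp : q p = 0)
    (hpos : ∀ s ∈ Set.Ioo (0 : ℝ) 1, 0 < q (m + s * (p - m)) * (p - m)) :
    ∃ g : ℝ → ℝ, (∀ t, HasDerivAt g (q (g t)) t) ∧ Tendsto g atBot (𝓝 m) ∧
      Tendsto g atTop (𝓝 p) := by
  have hd : p - m ≠ 0 := sub_ne_zero.2 hne.symm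
  obtain ⟨s, hs, hs0, hs1⟩ := exists_heteroclinic_unit (φ := fun s => q (m + s * (p - m)) / (p - m))
    (by fun_prop) (by simp [hm]) (by simp [hp]) (fun s h => by
      have := div_pos (hpos s h) (sq_pos_of_ne_zero hd)
      have e : q (m + s * (p - m)) * (p - m) / (p - m) ^ 2 = q (m + s * (p - m)) / (p - m) := by
        field_simp
      rwa [e] at this)
  refine ⟨fun t => m + s t * (p - m), fun t => ?_, ?_, ?_⟩
  · have := ((hs t).mul_const (p - m)).const_add m
    rwa [div_mul_cancel₀ _ hd] at this
  · simpa using (hs0.mul_const (p - m)).const_add m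
  · simpa using (hs1.mul_const (p - m)).const_add m

lemma integrable_and_integral_deriv_of_nonneg {G G' : ℝ → ℝ} (hG : ∀ t, HasDerivAt G (G' t) t)
    (hc : Continuous G') (h0 : ∀ t, 0 ≤ G' t) {A B : ℝ} (hA : Tendsto G atBot (𝓝 A))
    (hB : Tendsto G atTop (𝓝 B)) : Integrable G' ∧ ∫ t, G' t = B - A := by
  have hi : Integrable G' := by
    refine integrable_of_intervalIntegral_norm_tendsto (a := fun n : ℝ => -n) (b := fun n => n)
      (l := atTop) (B - A) (fun i => hc.integrableOn_Icc.mono_set Set.Ioc_subset_Icc_self)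
      tendsto_neg_atTop_atBot tendsto_id ?_
    have : (fun n : ℝ => ∫ x in -n..n, ‖G' x‖) = fun n => G n - G (-n) := by
      ext n
      simp only [Real.norm_of_nonneg (h0 _)]
      exact intervalIntegral.integral_eq_sub_of_hasDerivAt (fun x _ => hG x)
        (hc.intervalIntegrable _ _)
    rw [this]
    exact hB.sub (hA.comp tendsto_neg_atTop_atBot)
  exact ⟨hi, integral_of_hasDerivAt_of_tendsto hG hi hA hB⟩

/-- The heteroclinic orbit realizes the calibrated energy. -/
lemma lintegral_energy_heteroclinic {q Ψ : ℝ → ℝ} (hq : Continuous q)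
    (hΨ : ∀ s, HasDerivAt Ψ (q s) s) {g : ℝ → ℝ} (hg : ∀ t, HasDerivAt g (q (g t)) t) {m p : ℝ}
    (hgm : Tendsto g atBot (𝓝 m)) (hgp : Tendsto g atTop (𝓝 p)) :
    Integrable (fun t => q (g t) ^ 2) ∧
      ∫⁻ t, ENNReal.ofReal (1 / 2 * q (g t) ^ 2 + 1 / 2 * q (g t) ^ 2) =
        ENNReal.ofReal (Ψ p - Ψ m) := by
  have hgc : Continuous g := continuous_iff_continuousAt.2 fun t => (hg t).continuousAt
  obtain ⟨hi, hint⟩ := integrable_and_integral_deriv_of_nonneg (G := fun t => Ψ (g t))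
    (G' := fun t => q (g t) ^ 2) (fun t => by
      have := (hΨ (g t)).comp t (hg t)
      rwa [← sq] at this) (by fun_prop) (fun t => sq_nonneg _)
    ((hΨ m).continuousAt.tendsto.comp hgm) ((hΨ p).continuousAt.tendsto.comp hgp)
  refine ⟨hi, ?_⟩
  rw [← hint, ofReal_integral_eq_lintegral_ofReal hi (Eventually.of_forall fun t => sq_nonneg _)]
  congr 1
  ext t
  congr 1
  ring

/-- Equality in the calibration inequality forces the first-order equation. -/
lemma hasDerivAt_of_energy_le {q Ψ : ℝ → ℝ} (hq : Continuous q)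
    (hΨ : ∀ s, HasDerivAt Ψ (q s) s) {g : ℝ → ℝ} (hg : Differentiable ℝ g) {m p : ℝ}
    (hgm : Tendsto g atBot (𝓝 m)) (hgp : Tendsto g atTop (𝓝 p))
    (hE : ∫⁻ t, ENNReal.ofReal (1 / 2 * deriv g t ^ 2 + 1 / 2 * q (g t) ^ 2) ≤
      ENNReal.ofReal (Ψ p - Ψ m)) (hpm : 0 ≤ Ψ p - Ψ m) (t : ℝ) : HasDerivAt g (q (g t)) t := by
  have hgc := hg.continuous
  have hmd : Measurable (deriv g) := measurable_deriv g
  have hqg : Continuous fun t => q (g t) := by fun_prop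
  have he0 : ∀ t, 0 ≤ 1 / 2 * deriv g t ^ 2 + 1 / 2 * q (g t) ^ 2 := fun t => by positivity
  have hei : Integrable (fun t => 1 / 2 * deriv g t ^ 2 + 1 / 2 * q (g t) ^ 2) :=
    ⟨(((hmd.pow_const 2).const_mul _).add ((hqg.measurable.pow_const 2).const_mul _)).aestronglyMeasurable,
      by
        rw [hasFiniteIntegral_iff_ofReal (Eventually.of_forall he0)]
        exact hE.trans_lt ENNReal.ofReal_lt_top⟩
  have hpi : Integrable (fun t => q (g t) * deriv g t) := by
    refine hei.mono' (hqg.measurable.mul hmd).aestronglyMeasurable (Eventually.of_forall fun t => ?_)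
    rw [Real.norm_eq_abs]
    exact abs_le.2 ⟨by nlinarith [sq_nonneg (deriv g t + q (g t))],
      by nlinarith [sq_nonneg (deriv g t - q (g t))]⟩
  have hint := integral_of_hasDerivAt_of_tendsto (f := fun t => Ψ (g t))
    (fun t => (hΨ (g t)).comp t (hg t).hasDerivAt) hpi
    ((hΨ m).continuousAt.tendsto.comp hgm) ((hΨ p).continuousAt.tendsto.comp hgp)
  have hEle : ∫ t, (1 / 2 * deriv g t ^ 2 + 1 / 2 * q (g t) ^ 2) ≤ Ψ p - Ψ m := by
    rw [integral_eq_lintegral_of_nonneg_ae (Eventually.of_forall he0) hei.1]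
    exact ENNReal.toReal_le_of_le_ofReal hpm hE
  have hsub := integral_sub hei hpi
  have hsq : ∀ t, (1 / 2 * deriv g t ^ 2 + 1 / 2 * q (g t) ^ 2) - q (g t) * deriv g t =
      1 / 2 * (deriv g t - q (g t)) ^ 2 := fun t => by ring
  have hz : ∫ t, ((1 / 2 * deriv g t ^ 2 + 1 / 2 * q (g t) ^ 2) - q (g t) * deriv g t) = 0 := by
    refine le_antisymm (by rw [hsub, hint]; linarith) (integral_nonneg fun t => ?_)
    rw [hsq]; positivity
  have hae : deriv g =ᵐ[volume] fun t => q (g t) := by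
    filter_upwards [(integral_eq_zero_iff_of_nonneg (fun t =>
      (by positivity : 0 ≤ 1 / 2 * (deriv g t - q (g t)) ^ 2).trans_eq (hsq t).symm) (hei.sub hpi)).1 hz] with t ht
    have h2 : 1 / 2 * (deriv g t - q (g t)) ^ 2 = 0 := by rw [← hsq]; exact ht
    nlinarith [sq_nonneg (deriv g t - q (g t)), pow_eq_zero_iff (two_ne_zero) |>.1
      (by linarith : (deriv g t - q (g t)) ^ 2 = 0)]
  have hii : ∀ a b, IntervalIntegrable (deriv g) volume a b := fun a b =>
    (hqg.intervalIntegrable a b).congr_ae (ae_restrict_of_ae hae.symm)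
  have hrep : g = fun x => g 0 + ∫ r in (0 : ℝ)..x, q (g r) := by
    ext x
    rw [← intervalIntegral.integral_congr_ae (f := deriv g) (hae.mono fun t h _ => h),
      intervalIntegral.integral_deriv_eq_sub (fun x _ => hg x) (hii 0 x)]
    ring
  have := ((hqg.integral_hasStrictDerivAt 0 t).hasDerivAt).const_add (g 0)
  rw [← hrep] at this
  exact this

/-- Heteroclinic orbits of an autonomous scalar equation are unique up to translation. -/
lemma exists_translation_eq {q : ℝ → ℝ} (hq : ContDiff ℝ 1 q) {g γ : ℝ → ℝ}
    (hg : ∀ t, HasDerivAt g (q (g t)) t) (hγ : ∀ t, HasDerivAt γ (q (γ t)) t) {m p : ℝ}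
    (hne : m ≠ p) (hgm : Tendsto g atBot (𝓝 m)) (hgp : Tendsto g atTop (𝓝 p))
    (hγm : Tendsto γ atBot (𝓝 m)) (hγp : Tendsto γ atTop (𝓝 p)) :
    ∃ τ, ∀ t, γ t = g (t + τ) := by
  have bdd : ∀ h : ℝ → ℝ, Continuous h → Tendsto h atBot (𝓝 m) → Tendsto h atTop (𝓝 p) →
      (∃ R, ∀ t, |h t| ≤ R) ∧ ∃ t, h t = (m + p) / 2 := by
    intro h hc hm hp
    obtain ⟨T, hT⟩ := eventually_atTop.1 ((hp.abs).eventually_le_const (lt_add_one |p|))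
    obtain ⟨S, hS⟩ := eventually_atBot.1 ((hm.abs).eventually_le_const (lt_add_one |m|))
    obtain ⟨C, hC⟩ := (isCompact_Icc (a := S) (b := T)).exists_bound_of_continuousOn hc.continuousOn
    refine ⟨⟨max C (max (|p| + 1) (|m| + 1)), fun t => ?_⟩, ?_⟩
    · rcases le_total T t with h1 | h1
      · exact (hT t h1).trans ((le_max_left _ _).trans (le_max_right _ _))
      · rcases le_total t S with h2 | h2
        · exact (hS t h2).trans ((le_max_right _ _).trans (le_max_right _ _))
        · exact (hC t ⟨h2, h1⟩).trans (le_max_left _ _)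
    · rcases lt_or_gt_of_ne hne with hlt | hlt
      · obtain ⟨s, hs⟩ := (hm.eventually_lt_const (show m < (m + p) / 2 by linarith)).exists
        obtain ⟨t, ht⟩ := (hp.eventually_const_lt (show (m + p) / 2 < p by linarith)).exists
        exact mem_range_of_exists_le_of_exists_ge hc ⟨s, hs.le⟩ ⟨t, ht.le⟩
      · obtain ⟨s, hs⟩ := (hm.eventually_const_lt (show (m + p) / 2 < m by linarith)).exists
        obtain ⟨t, ht⟩ := (hp.eventually_lt_const (show p < (m + p) / 2 by linarith)).exists
        exact mem_range_of_exists_le_of_exists_ge hc ⟨t, ht.le⟩ ⟨s, hs.le⟩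
  obtain ⟨⟨R, hR⟩, s, hs⟩ := bdd g (continuous_iff_continuousAt.2 fun t => (hg t).continuousAt)
    hgm hgp
  obtain ⟨⟨R', hR'⟩, s', hs'⟩ := bdd γ (continuous_iff_continuousAt.2 fun t => (hγ t).continuousAt)
    hγm hγp
  obtain ⟨K, hK⟩ := exists_lipschitzOnWith_Icc hq (-max R R') (max R R')
  refine ⟨s - s', fun t => ?_⟩
  have := ODE_solution_unique_univ (v := fun _ => q) (s := fun _ => Set.Icc (-max R R') (max R R'))
    (fun _ => hK) (f := γ) (g := fun t => g (t + (s - s'))) (t₀ := s')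
    (fun t => ⟨hγ t, abs_le.1 ((hR' t).trans (le_max_right _ _))⟩)
    (fun t => ⟨(hg (t + (s - s'))).comp_add_const t _,
      abs_le.1 ((hR _).trans (le_max_left _ _))⟩) (by simp [hs', hs])
  exact congrFun this t

/-- Lebesgue measure on the strip `ℝ × [0,1]`. -/
def stripVol : Measure (ℝ × ℝ) := volume.prod (volume.restrict (Set.Icc (0 : ℝ) 1))

instance : IsProbabilityMeasure (volume.restrict (Set.Icc (0 : ℝ) 1)) :=
  ⟨by simp⟩

lemma toFin_eta (x : Fin 2 → ℝ) : toFin (x 0, x 1) = x := by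
  ext i; fin_cases i <;> rfl

lemma continuous_toFin : Continuous toFin :=
  continuous_iff_continuousAt.2 fun p => (hasFDerivAt_toFin p).continuousAt

lemma measurableEmbedding_toFin : MeasurableEmbedding toFin :=
  (MeasurableEquiv.finTwoArrow (α := ℝ)).symm.measurableEmbedding

lemma measurePreserving_toFin : MeasurePreserving toFin :=
  (volume_preserving_finTwoArrow ℝ).symm

lemma measurePreserving_toFin_strip :
    MeasurePreserving toFin stripVol (volume.restrict (strip 2)) := by
  have h := measurePreserving_toFin.restrict_preimage_emb measurableEmbedding_toFin (strip 2)
  have hpre : toFin ⁻¹' strip 2 = Set.univ ×ˢ Set.Ico (0 : ℝ) 1 := by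
    ext p
    simp [strip, toFin, Fin.forall_fin_two]
  rw [hpre, Measure.volume_eq_prod, ← Measure.prod_restrict, Measure.restrict_univ,
    Measure.restrict_congr_set Ico_ae_eq_Icc] at h
  exact h

lemma lintegral_strip (F : (Fin 2 → ℝ) → ℝ≥0∞) :
    ∫⁻ x in strip 2, F x = ∫⁻ p, F (toFin p) ∂stripVol :=
  (measurePreserving_toFin_strip.lintegral_comp_emb measurableEmbedding_toFin F).symm

lemma integrableOn_strip_iff {F : (Fin 2 → ℝ) → ℝ} :
    IntegrableOn F (strip 2) ↔ Integrable (fun p => F (toFin p)) stripVol :=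
  (measurePreserving_toFin_strip.integrable_comp_emb measurableEmbedding_toFin).symm

lemma measurePreserving_fst_stripVol : MeasurePreserving Prod.fst stripVol volume :=
  measurePreserving_fst

lemma boxVol_le_stripVol (s t : ℝ) : boxVol s t ≤ stripVol := by
  have : boxVol s t = stripVol.restrict (Set.Icc s t ×ˢ Set.univ) := by
    rw [boxVol_eq, stripVol, ← Measure.prod_restrict, Measure.restrict_univ]
  rw [this]
  exact Measure.restrict_le_self

lemma pd_apply {u : (Fin 2 → ℝ) → Fin 2 → ℝ} (hu : Differentiable ℝ u) (i j : Fin 2)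
    (x : Fin 2 → ℝ) : pd i u x j = pdS i (fun z => u z j) x := by
  rw [pd, pdS, (hasFDerivAt_pi'.1 (hu x).hasFDerivAt j).fderiv]
  rfl

lemma avg_apply {u : (Fin 2 → ℝ) → Fin 2 → ℝ} (hu : Continuous u) (t : ℝ) (i : Fin 2) :
    avg u t i = ∫ y in (0 : ℝ)..1, u (toFin (t, y)) i := by
  have hpre : toFin ⁻¹' cube 2 = Set.Ico (0 : ℝ) 1 ×ˢ Set.Ico (0 : ℝ) 1 := by
    ext p
    simp [cube, toFin, Fin.forall_fin_two]
  have hsub : cube 2 ⊆ Set.Icc 0 1 := fun y hy =>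
    ⟨fun j => (hy j trivial).1, fun j => (hy j trivial).2.le⟩
  have hupd : Continuous fun y : Fin 2 → ℝ => Function.update y 0 t :=
    continuous_id.update 0 continuous_const
  have hint : ∀ j, Integrable (fun y => u (Function.update y 0 t) j)
      (volume.restrict (cube 2)) := fun j =>
    (((continuous_apply j).comp (hu.comp hupd)).continuousOn.integrableOn_compact
      isCompact_Icc).mono_set hsub
  have htf : ∀ p, Function.update (toFin p) 0 t = toFin (t, p.2) := fun p => by
    ext j; fin_cases j <;> simp [toFin]
  rw [avg, eval_integral hint, ← measurePreserving_toFin.setIntegral_preimage_emb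
    measurableEmbedding_toFin, hpre, Measure.volume_eq_prod, ← Measure.prod_restrict]
  simp only [htf]
  rw [integral_fun_snd (f := fun y => u (toFin (t, y)) i), intervalIntegral.integral_of_le zero_le_one,
    Measure.restrict_congr_set Ico_ae_eq_Ioc]
  simp [Measure.real]

lemma avg_curve (γ : ℝ → Fin 2 → ℝ) (t : ℝ) : avg (fun x : Fin 2 → ℝ => γ (x 0)) t = γ t := by
  have : (volume : Measure (Fin 2 → ℝ)).real (cube 2) = 1 := by
    rw [cube, Measure.real, Real.volume_pi_Ico_toReal]
    · simp
    · exact fun _ => zero_le_one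
  simp [avg, this]

lemma pd_curve {γ : ℝ → Fin 2 → ℝ} (hγ : Differentiable ℝ γ) (i : Fin 2) (x : Fin 2 → ℝ) :
    pd i (fun x : Fin 2 → ℝ => γ (x 0)) x = (Pi.single i (1 : ℝ) : Fin 2 → ℝ) 0 • deriv γ (x 0) := by
  have h := (hγ (x 0)).hasFDerivAt.comp x (hasFDerivAt_apply (𝕜 := ℝ) (0 : Fin 2) x)
  have := h.fderiv
  rw [pd, show (fun x : Fin 2 → ℝ => γ (x 0)) = γ ∘ fun x => x 0 from rfl, this]
  rw [← fderiv_apply_one_eq_deriv, ← map_smul]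
  simp

lemma gradSq_curve {γ : ℝ → Fin 2 → ℝ} (hγ : Differentiable ℝ γ) (x : Fin 2 → ℝ) :
    gradSq (fun x : Fin 2 → ℝ => γ (x 0)) x = vnorm2 (deriv γ (x 0)) := by
  simp [gradSq, vnorm2, pd_curve hγ]

lemma measurable_vnorm2_deriv (γ : ℝ → Fin 2 → ℝ) : Measurable fun t => vnorm2 (deriv γ t) := by
  have := measurable_deriv γ
  unfold vnorm2
  fun_prop

lemma vnorm2_nonneg {d : ℕ} (v : Fin d → ℝ) : 0 ≤ vnorm2 v :=
  Finset.sum_nonneg fun _ _ => sq_nonneg _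

lemma energy_curve {W : (Fin 2 → ℝ) → ℝ} (hW : Continuous W) {γ : ℝ → Fin 2 → ℝ}
    (hγ : Differentiable ℝ γ) :
    energy 2 W (fun x => γ (x 0)) = energy1D 2 W γ := by
  have hm := measurable_vnorm2_deriv γ
  have hWγ : Continuous fun t => W (γ t) := hW.comp hγ.continuous
  rw [energy, lintegral_strip, energy1D, ← measurePreserving_fst_stripVol.lintegral_comp]
  · simp only [eden, gradSq_curve hγ]
    rfl
  · exact ((hm.const_mul _).add hWγ.measurable).ennreal_ofReal

lemma adm_curve {W : (Fin 2 → ℝ) → ℝ} (hW0 : ∀ z, 0 ≤ W z)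
    {a : ℝ} {um up : Fin 2 → ℝ} {γ : ℝ → Fin 2 → ℝ} (hγ : Adm1D 2 a um up γ)
    (hfin : energy1D 2 W γ ≠ ∞) :
    Adm 2 (fun x => γ (x 0)) ∧ BdryCond 2 (fun x => γ (x 0)) um up := by
  obtain ⟨hd, ha, hm, hp⟩ := hγ
  refine ⟨⟨hd.comp (differentiable_apply 0), fun x i hi => ?_, fun x => ?_, ?_⟩, ?_, ?_⟩
  · simp [Pi.single_eq_of_ne hi.symm]
  · have h0 : deriv γ (x 0) 0 = 0 := by
      have h := hasDerivAt_pi.1 (hd (x 0)).hasDerivAt 0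
      simp only [ha] at h
      exact h.unique (hasDerivAt_const _ _)
    simp [pd_curve hd, Fin.sum_univ_two, h0]
  · rw [integrableOn_strip_iff]
    simp only [gradSq_curve hd]
    have hm := measurable_vnorm2_deriv γ
    have hi : Integrable fun t => vnorm2 (deriv γ t) := by
      refine ⟨hm.aestronglyMeasurable, ?_⟩
      rw [hasFiniteIntegral_iff_ofReal (Eventually.of_forall fun t => vnorm2_nonneg _)]
      calc ∫⁻ t, ENNReal.ofReal (vnorm2 (deriv γ t))
          ≤ ∫⁻ t, 2 * ENNReal.ofReal (1 / 2 * vnorm2 (deriv γ t) + W (γ t)) := by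
            refine lintegral_mono fun t => ?_
            rw [show (2 : ℝ≥0∞) = ENNReal.ofReal 2 by simp, ← ENNReal.ofReal_mul zero_le_two]
            exact ENNReal.ofReal_le_ofReal (by linarith [hW0 (γ t)])
        _ = 2 * energy1D 2 W γ := lintegral_const_mul' _ _ (by simp)
        _ < ∞ := ENNReal.mul_lt_top (by simp) hfin.lt_top
    exact (measurePreserving_fst_stripVol.integrable_comp hi.aestronglyMeasurable).2 hi
  · rw [funext (avg_curve γ)]; exact hm
  · rw [funext (avg_curve γ)]; exact hp

lemma energy1D_eq_snd {W : (Fin 2 → ℝ) → ℝ} {a : ℝ} {um up : Fin 2 → ℝ} {γ : ℝ → Fin 2 → ℝ}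
    (hγ : Adm1D 2 a um up γ) {q : ℝ → ℝ} (hWq : ∀ s, W (toFin (a, s)) = 1 / 2 * q s ^ 2) :
    energy1D 2 W γ = ∫⁻ t, ENNReal.ofReal
      (1 / 2 * deriv (fun t => γ t 1) t ^ 2 + 1 / 2 * q (γ t 1) ^ 2) := by
  refine lintegral_congr fun t => ?_
  have h := hasDerivAt_pi.1 (hγ.1 t).hasDerivAt
  have h0 : deriv γ t 0 = 0 := by
    have h := h 0
    simp only [hγ.2.1] at h
    exact h.unique (hasDerivAt_const _ _)
  have hz : γ t = toFin (a, γ t 1) := by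
    rw [← hγ.2.1 t, toFin_eta]
  rw [(h 1).deriv, vnorm2, Fin.sum_univ_two, h0, ← hWq, ← hz]
  congr 1
  ring

/-- A calibrated upper bound on the energy forces the first component to be constant. -/
lemma fst_eq_of_energy_le {w : (Fin 2 → ℝ) → ℝ} (hw : ContDiff ℝ 2 w) {f : ℝ → ℝ}
    (hf : Continuous f) (hfb : ∀ s, |f s| ≤ 1) {W : (Fin 2 → ℝ) → ℝ}
    (hW : ∀ z, W z = (1 / 2) * w z ^ 2) {a : ℝ} {um up : Fin 2 → ℝ} (hum : um 0 = a)
    (hup : up 0 = a) {u : (Fin 2 → ℝ) → Fin 2 → ℝ} (hadm : Adm 2 u) (hbc : BdryCond 2 u um up)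
    {σ : ℝ} (hσ : σ * σ = 1) {D Φ1 Φ2 : ℝ × ℝ → ℝ}
    (h1 : HasGrad Φ1 D (fun p => σ * w (toFin p)))
    (h2 : HasGrad Φ2 (fun p => f p.1 * (σ * w (toFin p))) D)
    (hC : 0 ≤ Φ1 (a, up 1) - Φ1 (a, um 1))
    (hE : energy 2 W u ≤ ENNReal.ofReal (Φ1 (a, up 1) - Φ1 (a, um 1))) (x : Fin 2 → ℝ) :
    u x 0 = a := by
  obtain ⟨hu, hper, hdiv, hint⟩ := hadm
  have hcomp : ∀ j, HasGrad (fun p => u (toFin p) j) (fun p => pd 0 u (toFin p) j)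
      (fun p => pd 1 u (toFin p) j) := fun j =>
    (hasGrad_comp_toFin (g := fun z => u z j) fun z => (differentiableAt_pi.1 (hu z)) j).congr
      (fun p => (pd_apply hu 0 j _).symm) fun p => (pd_apply hu 1 j _).symm
  have hperj : ∀ j, PerY fun p => u (toFin p) j := fun j x y => by
    have h := hper (toFin (x, y)) 1 one_ne_zero
    have e : toFin (x, y) + Pi.single 1 1 = toFin (x, y + 1) := by
      ext i; fin_cases i <;> simp [toFin]
    rw [e] at h
    simp only [h]
  have hgs : ∀ x, gradSq u x = pd 0 u x 0 ^ 2 + pd 0 u x 1 ^ 2 + (pd 1 u x 0 ^ 2 + pd 1 u x 1 ^ 2) :=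
    fun x => by simp [gradSq, Fin.sum_univ_two]
  have hsq : ∀ x i j, pd i u x j ^ 2 ≤ gradSq u x := fun x i j => by
    refine (Finset.single_le_sum (f := fun j => pd i u x j ^ 2) (fun _ _ => sq_nonneg _)
      (Finset.mem_univ j)).trans ?_
    exact Finset.single_le_sum (f := fun i => ∑ j, pd i u x j ^ 2)
      (fun _ _ => Finset.sum_nonneg fun _ _ => sq_nonneg _) (Finset.mem_univ i)
  have hintS : Integrable (fun p => gradSq u (toFin p)) stripVol := integrableOn_strip_iff.1 hint
  have hL2 : ∀ (F : ℝ × ℝ → ℝ), Measurable F → (∀ p, F p ^ 2 ≤ gradSq u (toFin p)) →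
      ∀ s t, MemLp F 2 (boxVol s t) := fun F hF hle s t => by
    rw [memLp_two_iff_integrable_sq hF.aestronglyMeasurable]
    refine (hintS.mono_measure (boxVol_le_stripVol s t)).mono'
      (hF.pow_const 2).aestronglyMeasurable (Eventually.of_forall fun p => ?_)
    rw [Real.norm_of_nonneg (sq_nonneg _)]
    exact hle p
  have havg : ∀ j t, ∫ y in (0 : ℝ)..1, u (toFin (t, y)) j = avg u t j := fun j t =>
    (avg_apply hu.continuous t j).symm
  have hlim : ∀ {l : Filter ℝ} {v : Fin 2 → ℝ}, Tendsto (avg u) l (𝓝 v) → ∀ j,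
      Tendsto (fun t => ∫ y in (0 : ℝ)..1, u (toFin (t, y)) j) l (𝓝 (v j)) := fun h j => by
    simp only [havg]
    exact tendsto_pi_nhds.1 h j
  have hσw := (hasGrad_comp_toFin (hw.differentiable two_ne_zero)).const_mul σ
  have hw1 : Continuous fun p => σ * pdS 0 w (toFin p) :=
    continuous_const.mul ((contDiff_pdS hw 0).continuous.comp continuous_toFin)
  have hw2 : Continuous fun p => σ * pdS 1 w (toFin p) :=
    continuous_const.mul ((contDiff_pdS hw 1).continuous.comp continuous_toFin)
  have key := fst_eq_of_calibrated (hcomp 0) (hcomp 1) (hperj 0) (hperj 1)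
    (hL2 _ (hcomp 0).measurable_fst fun p => hsq _ _ _)
    (hL2 _ (hcomp 0).measurable_snd fun p => hsq _ _ _)
    (hL2 _ (hcomp 1).measurable_fst fun p => hsq _ _ _)
    (hL2 _ (hcomp 1).measurable_snd fun p => hsq _ _ _)
    (by
      have hm : Measurable fun p : ℝ × ℝ =>
          ENNReal.ofReal (pd 1 u (toFin p) 0 ^ 2 + pd 1 u (toFin p) 1 ^ 2) :=
        (((hcomp 0).measurable_snd.pow_const 2).add
          ((hcomp 1).measurable_snd.pow_const 2)).ennreal_ofReal
      have := lintegral_prod (μ := volume) (ν := volume.restrict (Set.Icc (0 : ℝ) 1)) _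
        hm.aemeasurable
      rw [← this]
      refine (lt_of_le_of_lt (lintegral_mono fun p => ?_) hintS.lintegral_lt_top).ne
      refine ENNReal.ofReal_le_ofReal ?_
      rw [hgs]
      nlinarith [sq_nonneg (pd 0 u (toFin p) 1), sq_nonneg (pd 0 u (toFin p) 0)])
    (fun p => by simpa [Fin.sum_univ_two] using hdiv (toFin p)) hf hfb hσw hw1 hw2 h1 h2
    (hum ▸ hlim hbc.1 0) (hup ▸ hlim hbc.2 0) (hlim hbc.1 1) (hlim hbc.2 1)
    (fun s t => by
      have hWc : Continuous W := by
        rw [funext hW]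
        exact continuous_const.mul (hw.continuous.pow 2)
      have e : ∀ p : ℝ × ℝ, 1 / 2 * (pd 0 u (toFin p) 0 ^ 2 + pd 1 u (toFin p) 0 ^ 2 +
          pd 0 u (toFin p) 1 ^ 2 + pd 1 u (toFin p) 1 ^ 2) +
          1 / 2 * (σ * w (toFin (u (toFin p) 0, u (toFin p) 1))) ^ 2 = eden W u (toFin p) :=
        fun p => by
          rw [toFin_eta, eden, hgs, hW, mul_pow, sq σ, hσ]
          ring
      simp only [e]
      have hmeas : Measurable fun p => eden W u (toFin p) := by
        have h1 := (hcomp 0).measurable_fst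
        have h2 := (hcomp 0).measurable_snd
        have h3 := (hcomp 1).measurable_fst
        have h4 := (hcomp 1).measurable_snd
        have h5 : Measurable fun p => W (u (toFin p)) :=
          (hWc.comp (hu.continuous.comp continuous_toFin)).measurable
        simp only [eden, hgs]
        exact ((((h1.pow_const 2).add (h3.pow_const 2)).add
          ((h2.pow_const 2).add (h4.pow_const 2))).const_mul _).add h5
      rw [integral_eq_lintegral_of_nonneg_ae (Eventually.of_forall fun p => ?_)
        hmeas.aestronglyMeasurable]
      · refine ENNReal.toReal_le_of_le_ofReal hC ?_
        refine (lintegral_mono' (boxVol_le_stripVol s t) le_rfl).trans ?_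
        rw [energy, lintegral_strip] at hE
        exact hE
      · show 0 ≤ eden W u (toFin p)
        rw [← e]
        positivity)
    (x 0, x 1)
  rwa [toFin_eta] at key

lemma eq_curve_of_fst_eq {u : (Fin 2 → ℝ) → Fin 2 → ℝ} (hu : Differentiable ℝ u)
    (hdiv : IsDivFree u) {a : ℝ} (ha : ∀ x, u x 0 = a) (x : Fin 2 → ℝ) :
    u x = u (toFin (x 0, 0)) := by
  have hpd : ∀ z, pd 0 u z 0 = 0 := fun z => by
    rw [pd_apply hu, pdS]
    simp [ha]
  ext j
  fin_cases j
  · simp [ha]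
  · have h := hasGrad_comp_toFin (g := fun z => u z 1) fun z => (differentiableAt_pi.1 (hu z)) 1
    have h0 : ∀ y, HasDerivAt (fun y => u (toFin (x 0, y)) 1) 0 y := fun y => by
      have h1 := h.hasDerivAt_snd (x 0) y
      have h2 := hdiv (toFin (x 0, y))
      rw [Fin.sum_univ_two, hpd, zero_add, pd_apply hu] at h2
      rwa [h2] at h1
    have := is_const_of_deriv_eq_zero (fun y => (h0 y).differentiableAt) (fun y => (h0 y).deriv)
      (x 1) 0
    rw [toFin_eta] at this
    exact this

/-- Theorem `thm:tricomi`: in dimension `d = 2`, for `W = ½w²` with `w` a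
solution of the Tricomi equation `∂₁₁w - f(z₁)∂₂₂w = 0` (`f ∈ C¹`, `|f| ≤ 1`) and `w > 0` on
the open segment `(u⁻,u⁺)`, every global minimizer of `(P)` (bounded, or with `|∇w|` of at
most Gaussian-exponential growth) is one-dimensional: `u = g(x₁)` with `g` the unique (up to
translation) minimizer of the one-dimensional problem. -/
theorem statement7
    (w : (Fin 2 → ℝ) → ℝ) (hw : ContDiff ℝ 2 w)
    (f : ℝ → ℝ) (hf : ContDiff ℝ 1 f) (hfb : ∀ s, |f s| ≤ 1)
    (heq : ∀ z : Fin 2 → ℝ, pdS 0 (pdS 0 w) z - f (z 0) * pdS 1 (pdS 1 w) z = 0)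
    (W : (Fin 2 → ℝ) → ℝ) (hW : ∀ z, W z = (1 / 2) * w z ^ 2)
    (a : ℝ) (um up : Fin 2 → ℝ) (hum : um 0 = a) (hup : up 0 = a) (hne : um ≠ up)
    (hWm : W um = 0) (hWp : W up = 0)
    (hwpos : ∀ t : ℝ, t ∈ Set.Ioo (0 : ℝ) 1 → 0 < w (um + t • (up - um)))
    (u : (Fin 2 → ℝ) → Fin 2 → ℝ)
    (hadm : Adm 2 u) (hbc : BdryCond 2 u um up)
    (hmin : ∀ v, Adm 2 v → BdryCond 2 v um up → energy 2 W u ≤ energy 2 W v)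
    (hside : (∃ M, ∀ x, ‖u x‖ ≤ M) ∨
      (∃ C > (0 : ℝ), ∃ β > (0 : ℝ), ∀ z,
        Real.sqrt (vnorm2 (fun i => pdS i w z)) ≤ C * Real.exp (β * vnorm2 z))) :
    ∃ g : ℝ → Fin 2 → ℝ,
      (∀ x, u x = g (x 0)) ∧
      Adm1D 2 a um up g ∧
      (∀ γ, Adm1D 2 a um up γ → energy1D 2 W g ≤ energy1D 2 W γ) ∧
      (∀ γ, Adm1D 2 a um up γ →
        (∀ γ', Adm1D 2 a um up γ' → energy1D 2 W γ ≤ energy1D 2 W γ') →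
        ∃ τ : ℝ, ∀ t, γ t = g (t + τ)) := by
  have hW0 : ∀ z, 0 ≤ W z := fun z => by rw [hW]; positivity
  have hWc : Continuous W := by
    rw [funext hW]
    exact continuous_const.mul (hw.continuous.pow 2)
  have hm_eq : toFin (a, um 1) = um := by rw [← hum, toFin_eta]
  have hp_eq : toFin (a, up 1) = up := by rw [← hup, toFin_eta]
  have hne1 : um 1 ≠ up 1 := fun h => hne (by rw [← hm_eq, ← hp_eq, h])
  have hwm : w um = 0 := by simpa [hW] using hWm
  have hwp : w up = 0 := by simpa [hW] using hWp
  obtain ⟨σ, hσ, hσpos⟩ : ∃ σ : ℝ, σ * σ = 1 ∧ 0 < σ * (up 1 - um 1) := by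
    rcases lt_or_gt_of_ne hne1 with h | h
    · exact ⟨1, by norm_num, by linarith⟩
    · exact ⟨-1, by norm_num, by linarith⟩
  obtain ⟨D, Φ1, Φ2, hΦ1, hΦ2⟩ := exists_tricomi_potentials hw hf heq
  have h1 := hΦ1.const_mul σ
  have h2 := (hΦ2.const_mul σ).congr (gx' := fun p => f p.1 * (σ * w (toFin p)))
    (fun p => by ring) fun p => rfl
  set q : ℝ → ℝ := fun s => σ * w (toFin (a, s)) with hq
  have hqC : ContDiff ℝ 1 q := by
    have : ContDiff ℝ 1 fun s : ℝ => toFin (a, s) :=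
      (ContinuousLinearEquiv.finTwoArrow ℝ ℝ).symm.contDiff.comp
        (contDiff_const.prodMk contDiff_id)
    exact contDiff_const.mul ((hw.of_le one_le_two).comp this)
  have hΨ : ∀ s, HasDerivAt (fun s => σ * Φ1 (a, s)) (q s) s := fun s => h1.hasDerivAt_snd a s
  have hWq : ∀ s, W (toFin (a, s)) = 1 / 2 * q s ^ 2 := fun s => by
    rw [hW, hq, mul_pow, sq σ, hσ, one_mul]
  obtain ⟨g₀, hg₀, hg₀m, hg₀p⟩ := exists_heteroclinic hqC hne1 (by simp [hq, hm_eq, hwm])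
    (by simp [hq, hp_eq, hwp]) (fun s hs => by
      have e : um + s • (up - um) = toFin (a, um 1 + s * (up 1 - um 1)) := by
        ext i; fin_cases i <;> simp [toFin, hum, hup]
      have := mul_pos hσpos (hwpos s hs)
      rw [e] at this
      simp only [hq]
      linarith)
  obtain ⟨-, hg₀E⟩ := lintegral_energy_heteroclinic hqC.continuous hΨ hg₀ hg₀m hg₀p
  have hC : 0 ≤ σ * Φ1 (a, up 1) - σ * Φ1 (a, um 1) := by
    obtain ⟨-, h⟩ := integrable_and_integral_deriv_of_nonneg (G := fun t => σ * Φ1 (a, g₀ t))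
      (G' := fun t => q (g₀ t) ^ 2) (fun t => by
        rw [sq]; exact (hΨ (g₀ t)).comp t (hg₀ t))
      ((hqC.continuous.comp (continuous_iff_continuousAt.2 fun t =>
        (hg₀ t).continuousAt)).pow 2) (fun t => sq_nonneg _)
      ((hΨ _).continuousAt.tendsto.comp hg₀m) ((hΨ _).continuousAt.tendsto.comp hg₀p)
    rw [← h]
    exact integral_nonneg fun t => sq_nonneg _
  have hγ₀ : Adm1D 2 a um up fun t => toFin (a, g₀ t) := by
    refine ⟨fun t => ?_, fun t => rfl, ?_, ?_⟩
    · exact (hasFDerivAt_toFin _).differentiableAt.comp t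
        ((differentiableAt_const a).prodMk (hg₀ t).differentiableAt)
    · have := (continuous_toFin.tendsto (a, um 1)).comp (tendsto_const_nhds.prodMk_nhds hg₀m)
      rwa [hm_eq] at this
    · have := (continuous_toFin.tendsto (a, up 1)).comp (tendsto_const_nhds.prodMk_nhds hg₀p)
      rwa [hp_eq] at this
  have hγ₀E : energy1D 2 W (fun t => toFin (a, g₀ t)) =
      ENNReal.ofReal (σ * Φ1 (a, up 1) - σ * Φ1 (a, um 1)) := by
    rw [energy1D_eq_snd hγ₀ hWq, ← hg₀E]
    refine lintegral_congr fun t => ?_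
    have e : (fun t => toFin (a, g₀ t) 1) = g₀ := rfl
    rw [e, (hg₀ t).deriv]
    rfl
  have hle : ∀ γ, Adm1D 2 a um up γ → energy 2 W u ≤ energy1D 2 W γ := fun γ hγ => by
    by_cases hfin : energy1D 2 W γ = ∞
    · rw [hfin]; exact le_top
    · obtain ⟨hA, hB⟩ := adm_curve hW0 hγ hfin
      exact (hmin _ hA hB).trans_eq (energy_curve hWc hγ.1)
  have hfst := fst_eq_of_energy_le hw hf.continuous hfb hW hum hup hadm hbc hσ h1 h2 hC
    ((hle _ hγ₀).trans_eq hγ₀E)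
  have hug : ∀ x, u x = u (toFin (x 0, 0)) := eq_curve_of_fst_eq hadm.1 hadm.2.2.1 hfst
  have hug' : u = fun x => (fun t => u (toFin (t, 0))) (x 0) := funext hug
  have hgd : Differentiable ℝ fun t => u (toFin (t, 0)) := fun t =>
    (hadm.1 _).comp t ((hasFDerivAt_toFin _).differentiableAt.comp t
      (differentiableAt_id.prodMk (differentiableAt_const 0)))
  have havg : avg u = fun t => u (toFin (t, 0)) := by
    rw [hug', funext (avg_curve fun t => u (toFin (t, 0)))]
    exact funext fun t => hug (toFin (t, 0))
  have hgA : Adm1D 2 a um up fun t => u (toFin (t, 0)) :=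
    ⟨hgd, fun t => hfst _, havg ▸ hbc.1, havg ▸ hbc.2⟩
  have hgE : energy 2 W u = energy1D 2 W fun t => u (toFin (t, 0)) := by
    rw [← energy_curve hWc hgd, ← hug']
  have hode : ∀ γ, Adm1D 2 a um up γ →
      energy1D 2 W γ ≤ energy1D 2 W (fun t => toFin (a, g₀ t)) →
      ∀ t, HasDerivAt (fun t => γ t 1) (q (γ t 1)) t := fun γ hγ hle => by
    rw [hγ₀E, energy1D_eq_snd hγ hWq] at hle
    exact hasDerivAt_of_energy_le hqC.continuous hΨ
      (fun t => (differentiableAt_pi.1 (hγ.1 t)) 1) (tendsto_pi_nhds.1 hγ.2.2.1 1)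
      (tendsto_pi_nhds.1 hγ.2.2.2 1) hle hC
  have hgmin : ∀ γ, Adm1D 2 a um up γ →
      energy1D 2 W (fun t => u (toFin (t, 0))) ≤ energy1D 2 W γ := fun γ hγ => by
    rw [← hgE]; exact hle γ hγ
  refine ⟨fun t => u (toFin (t, 0)), hug, hgA, hgmin, fun γ hγ hγmin => ?_⟩
  obtain ⟨τ, hτ⟩ := exists_translation_eq hqC (hode _ hgA (hgmin _ hγ₀))
    (hode γ hγ (hγmin _ hγ₀)) hne1 (tendsto_pi_nhds.1 hgA.2.2.1 1)
    (tendsto_pi_nhds.1 hgA.2.2.2 1) (tendsto_pi_nhds.1 hγ.2.2.1 1)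
    (tendsto_pi_nhds.1 hγ.2.2.2 1)
  refine ⟨τ, fun t => ?_⟩
  ext i
  fin_cases i
  · exact (hγ.2.1 t).trans (hgA.2.1 _).symm
  · exact hτ t
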